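/- There is a family {F_n} of unsatisfiable 3-CNF formulas with Θ(n) clauses and variables such that, over any field F: (1) F_n has a Nullstellensatz refutation of degree O(log² n); (2) for every constant δ > 0, F_n has a Nullstellensatz refutation of size O(n) and degree O(n / log^{1−δ} n); and (3) there is a constant K > 0 such that every Nullstellensatz refutation of F_n of degree at most K·n/log n has size n^{Ω(log log n)} (i.e., at least n^{c·log log n} for some constant c > 0 and all sufficiently large n). -/

import Mathlib

open MvPolynomial

/-- A Nullstellensatz certificate (refutation): `∑ i, r i * p i + ∑ j, s j * (X j ^ 2 - X j) = 1`. -/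
def IsNSCert {F σ ι : Type} [Field F] [Fintype σ] [Fintype ι]
    (p r : ι → MvPolynomial σ F) (s : σ → MvPolynomial σ F) : Prop :=
  ∑ i, r i * p i + ∑ j, s j * (X j ^ 2 - X j) = 1

/-- The size of a Nullstellensatz refutation:
`∑ i, m(r i) * m(p i) + ∑ j, 2 * m(s j)` where `m` counts monomials. -/
noncomputable def nsSize {F σ ι : Type} [Field F] [Fintype σ] [Fintype ι]
    (p r : ι → MvPolynomial σ F) (s : σ → MvPolynomial σ F) : ℕ :=
  ∑ i, (r i).support.card * (p i).support.card + ∑ j, 2 * (s j).support.card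

/-- The degree of a Nullstellensatz refutation: the maximum of the degrees of the
polynomials `r i * p i` and `s j * (X j ^ 2 - X j)`. -/
noncomputable def nsDegree {F σ ι : Type} [Field F] [Fintype σ] [Fintype ι]
    (p r : ι → MvPolynomial σ F) (s : σ → MvPolynomial σ F) : ℕ :=
  max (Finset.univ.sup fun i => (r i * p i).totalDegree)
    (Finset.univ.sup fun j => (s j * (X j ^ 2 - X j)).totalDegree)

/-- A clause over `n` Boolean variables, given by its sets of positive and negative literals. -/
abbrev Clause (n : ℕ) := Finset (Fin n) × Finset (Fin n)

/-- A CNF formula: a number of variables together with a set of clauses. -/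
structure CNF where
  nvars : ℕ
  clauses : Finset (Clause nvars)

/-- A 3-CNF formula: every clause has at most 3 literals. -/
def CNF.Is3CNF (φ : CNF) : Prop := ∀ C ∈ φ.clauses, C.1.card + C.2.card ≤ 3

/-- Satisfaction of a clause by a Boolean assignment. -/
def Clause.Sat {n : ℕ} (a : Fin n → Bool) (C : Clause n) : Prop :=
  (∃ x ∈ C.1, a x = true) ∨ (∃ y ∈ C.2, a y = false)

/-- Unsatisfiability of a CNF formula. -/
def CNF.Unsat (φ : CNF) : Prop :=
  ∀ a : Fin φ.nvars → Bool, ∃ C ∈ φ.clauses, ¬ Clause.Sat a C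

/-- The polynomial translation `∏_{x ∈ P}(1 - x) * ∏_{y ∈ N} y` of a clause. -/
noncomputable def Clause.poly (F : Type) [Field F] {n : ℕ} (C : Clause n) :
    MvPolynomial (Fin n) F :=
  (∏ x ∈ C.1, (1 - X x)) * ∏ y ∈ C.2, X y

/-- The family of polynomial translations of the clauses of a CNF formula. -/
noncomputable def CNF.polys (F : Type) [Field F] (φ : CNF) :
    {C // C ∈ φ.clauses} → MvPolynomial (Fin φ.nvars) F :=
  fun C => Clause.poly F C.1

/-! ### Random expanders -/

lemma exists_avoiding (w w' D : ℕ) (hw' : 0 < w')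
    (S : Finset (Finset (Fin w) × Finset (Fin w')))
    (h : ∑ p ∈ S, ((p.2.card : ℝ) / w') ^ (D * p.1.card) < 1) :
    ∃ f : Fin D → Fin w → Fin w', ∀ p ∈ S, ¬ ∀ x ∈ p.1, ∀ d, f d x ∈ p.2 := by
  classical
  by_contra hcon
  push Not at hcon
  let bad : Finset (Fin w) × Finset (Fin w') → Finset (Fin D × Fin w → Fin w') := fun p =>
    Fintype.piFinset fun q => if q.2 ∈ p.1 then p.2 else Finset.univ
  have hcov : (Finset.univ : Finset (Fin D × Fin w → Fin w')) ⊆ S.biUnion bad := by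
    intro g _
    obtain ⟨p, hp, hg⟩ := hcon fun d x => g (d, x)
    refine Finset.mem_biUnion.2 ⟨p, hp, ?_⟩
    refine Fintype.mem_piFinset.2 ?_
    rintro ⟨d, x⟩
    by_cases hx : x ∈ p.1
    · simpa [hx] using hg x hx d
    · simp [hx]
  have hbad : ∀ p, ((bad p).card : ℝ) = ((p.2.card : ℝ) / w') ^ (D * p.1.card) * (w' : ℝ) ^ (D * w) := by
    intro p
    have h1 : (bad p).card = p.2.card ^ (D * p.1.card) * w' ^ (D * (w - p.1.card)) := by
      simp only [bad, Fintype.card_piFinset]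
      rw [Fintype.prod_prod_type]
      simp only [apply_ite Finset.card, Finset.card_univ, Fintype.card_fin]
      simp only [Finset.prod_ite, Finset.prod_const]
      rw [Finset.filter_mem_eq_inter, Finset.univ_inter, Finset.card_univ, Fintype.card_fin]
      have : (Finset.univ.filter fun x => x ∉ p.1).card = w - p.1.card := by
        rw [Finset.filter_not, Finset.filter_mem_eq_inter, Finset.univ_inter,
          Finset.card_sdiff_of_subset (Finset.subset_univ _), Finset.card_univ, Fintype.card_fin]
      rw [this, mul_pow, ← pow_mul, ← pow_mul, mul_comm D, mul_comm D]
    have hle : p.1.card ≤ w := by simpa using Finset.card_le_univ p.1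
    have h2 : D * w = D * p.1.card + D * (w - p.1.card) := by
      rw [← Nat.mul_add, Nat.add_sub_cancel' hle]
    rw [h1, h2, pow_add, div_pow]
    have : (w' : ℝ) ≠ 0 := by positivity
    push_cast
    field_simp
  have hc := (Finset.card_le_card hcov).trans Finset.card_biUnion_le
  have hc' : ((w' : ℝ) ^ (D * w)) ≤ ∑ p ∈ S, ((bad p).card : ℝ) := by
    have : ((Finset.univ : Finset (Fin D × Fin w → Fin w')).card : ℝ) = (w' : ℝ) ^ (D * w) := by
      simp [Finset.card_univ]
    rw [← this]
    exact_mod_cast hc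
  simp only [hbad] at hc'
  rw [← Finset.sum_mul] at hc'
  have hpos : (0 : ℝ) < (w' : ℝ) ^ (D * w) := by positivity
  nlinarith

lemma choose_le_three (n k : ℕ) (hk : 1 ≤ k) : (n.choose k : ℝ) ≤ (3 * n / k : ℝ) ^ k := by
  have h1 : (n.choose k : ℝ) ≤ (n : ℝ) ^ k / (k.factorial : ℝ) := Nat.choose_le_pow_div k n
  have hkpos : (0 : ℝ) < k := by exact_mod_cast hk
  have h2 : ((k : ℝ) / 3) ^ k ≤ (k.factorial : ℝ) := by
    have h3 : (k : ℝ) ^ k / (k.factorial : ℝ) ≤ Real.exp k := by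
      exact Real.pow_div_factorial_le_exp (k : ℝ) (by positivity) k
    have h4 : Real.exp k ≤ 3 ^ k := by
      have : Real.exp (k : ℝ) = Real.exp 1 ^ k := by
        rw [← Real.exp_nat_mul, mul_one]
      rw [this]
      exact pow_le_pow_left₀ (by positivity) Real.exp_one_lt_three.le _
    have hf : (0 : ℝ) < k.factorial := by positivity
    rw [div_pow, div_le_iff₀ (by positivity)]
    rw [div_le_iff₀ hf] at h3
    nlinarith
  have hf : (0 : ℝ) < ((k : ℝ) / 3) ^ k := by positivity
  calc (n.choose k : ℝ) ≤ (n : ℝ) ^ k / (k.factorial : ℝ) := h1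
    _ ≤ (n : ℝ) ^ k / ((k : ℝ) / 3) ^ k := by gcongr
    _ = (3 * n / k : ℝ) ^ k := by
      rw [← div_pow]; congr 1; field_simp

/-- Shrinking expander. -/
lemma exists_shrink (w' D : ℕ) (hw' : 0 < w') (hD : 12 ≤ D) :
    ∃ f : Fin D → Fin (2 * w') → Fin w', ∀ (X : Finset (Fin (2 * w'))) (Y : Finset (Fin w')),
      (∀ x ∈ X, ∀ d, f d x ∈ Y) → 2 * X.card ≤ w' → X.card ≤ Y.card := by
  classical
  let Sk : ℕ → Finset (Finset (Fin (2 * w')) × Finset (Fin w')) := fun i =>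
    (Finset.powersetCard (i + 1) Finset.univ) ×ˢ (Finset.powersetCard (i + 1) Finset.univ)
  let S := (Finset.range (w' / 2)).biUnion Sk
  have hwp : (0 : ℝ) < w' := by exact_mod_cast hw'
  have hk : ∀ i ∈ Finset.range (w' / 2),
      ∑ p ∈ Sk i, ((p.2.card : ℝ) / w') ^ (D * p.1.card) ≤ (1 / 2 : ℝ) ^ (i + 1) := by
    intro i hi
    have hi' : 2 * (i + 1) ≤ w' := by have := Finset.mem_range.1 hi; omega
    have h1 : ∀ p ∈ Sk i, ((p.2.card : ℝ) / w') ^ (D * p.1.card)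
        = (((i + 1 : ℕ) : ℝ) / w') ^ (D * (i + 1)) := by
      intro p hp
      obtain ⟨ha, hb⟩ := Finset.mem_product.1 hp
      rw [(Finset.mem_powersetCard.1 ha).2, (Finset.mem_powersetCard.1 hb).2]
    rw [Finset.sum_congr rfl h1, Finset.sum_const, nsmul_eq_mul]
    have hc : (Sk i).card = (2 * w').choose (i + 1) * w'.choose (i + 1) := by
      simp [Sk, Finset.card_product, Finset.card_powersetCard]
    rw [hc]
    push_cast
    have ha := choose_le_three (2 * w') (i + 1) (by omega)
    have hb := choose_le_three w' (i + 1) (by omega)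
    push_cast at ha hb
    set κ : ℝ := (i : ℝ) + 1 with hκ
    have hκ0 : 0 < κ := by positivity
    have hκ2 : κ / w' ≤ 1 / 2 := by
      rw [div_le_div_iff₀ hwp (by norm_num)]
      have : ((2 * (i + 1) : ℕ) : ℝ) ≤ w' := by exact_mod_cast hi'
      push_cast at this
      linarith
    obtain ⟨e, rfl⟩ : ∃ e, D = e + 2 := ⟨D - 2, by omega⟩
    calc _ ≤ (3 * (2 * (w' : ℝ)) / κ) ^ (i + 1) * (3 * (w' : ℝ) / κ) ^ (i + 1)
            * (κ / w') ^ ((e + 2) * (i + 1)) := by gcongr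
      _ = (18 * (κ / w') ^ e) ^ (i + 1) := by
          rw [pow_mul, ← mul_pow, ← mul_pow]
          congr 1
          rw [pow_add]
          field_simp
          norm_num
      _ ≤ (18 * (1 / 2) ^ 10) ^ (i + 1) := by
          gcongr
          calc (κ / w') ^ e ≤ (1 / 2 : ℝ) ^ e := pow_le_pow_left₀ (by positivity) hκ2 _
            _ ≤ (1 / 2 : ℝ) ^ 10 := pow_le_pow_of_le_one (by norm_num) (by norm_num) (by omega)
      _ ≤ (1 / 2 : ℝ) ^ (i + 1) := pow_le_pow_left₀ (by norm_num) (by norm_num) _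
  have hgeo : ∀ N : ℕ, ∑ i ∈ Finset.range N, (1 / 2 : ℝ) ^ (i + 1) = 1 - (1 / 2) ^ N := by
    intro N
    induction N with
    | zero => simp
    | succ N ih => rw [Finset.sum_range_succ, ih, pow_succ]; ring
  obtain ⟨f, hf⟩ := exists_avoiding (2 * w') w' D hw' S (by
    have hdisj : ((Finset.range (w' / 2) : Finset ℕ) : Set ℕ).PairwiseDisjoint Sk := by
      intro i _ i' _ hne
      refine Finset.disjoint_left.2 fun p hp hp' => hne ?_
      have h1 := (Finset.mem_powersetCard.1 (Finset.mem_product.1 hp).1).2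
      have h2 := (Finset.mem_powersetCard.1 (Finset.mem_product.1 hp').1).2
      omega
    calc _ = ∑ i ∈ Finset.range (w' / 2), ∑ p ∈ Sk i, ((p.2.card : ℝ) / w') ^ (D * p.1.card) :=
          Finset.sum_biUnion hdisj
      _ ≤ ∑ i ∈ Finset.range (w' / 2), (1 / 2 : ℝ) ^ (i + 1) := Finset.sum_le_sum hk
      _ < 1 := by
          rw [hgeo]
          have : (0 : ℝ) < (1 / 2) ^ (w' / 2) := by positivity
          linarith)
  refine ⟨f, fun X Y hXY hX => ?_⟩
  by_contra hY
  have hX1 : 1 ≤ X.card := by omega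
  obtain ⟨Y', hYY', -, hY'⟩ := Finset.exists_subsuperset_card_eq (Finset.subset_univ Y)
    (n := X.card) (by omega) (by simp; omega)
  refine hf (X, Y') ?_ fun x hx d => hYY' (hXY x hx d)
  refine Finset.mem_biUnion.2 ⟨X.card - 1, Finset.mem_range.2 (by omega), ?_⟩
  have : X.card - 1 + 1 = X.card := by omega
  simp only [Sk, this]
  exact Finset.mem_product.2 ⟨Finset.mem_powersetCard.2 ⟨Finset.subset_univ _, rfl⟩,
    Finset.mem_powersetCard.2 ⟨Finset.subset_univ _, hY'⟩⟩

/-- Dense mixing expander. -/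
lemma exists_mix (w w' D : ℕ) (hw : 0 < w) (hw' : 0 < w') (hww : w' ≤ 2 * w) (hD : 300 ≤ D) :
    ∃ f : Fin D → Fin w → Fin w', ∀ (X : Finset (Fin w)) (Y : Finset (Fin w')),
      (∀ x ∈ X, ∀ d, f d x ∈ Y) → w ≤ 5 * X.card → 19 * w' ≤ 20 * Y.card := by
  classical
  let S : Finset (Finset (Fin w) × Finset (Fin w')) :=
    Finset.univ.filter fun p => w ≤ 5 * p.1.card ∧ 20 * p.2.card < 19 * w'
  obtain ⟨f, hf⟩ := exists_avoiding w w' D hw' S (by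
    have hterm : ∀ p ∈ S, ((p.2.card : ℝ) / w') ^ (D * p.1.card) ≤ ((1 : ℝ) / 9) ^ w := by
      intro p hp
      obtain ⟨h1, h2⟩ := (Finset.mem_filter.1 hp).2
      have hwp : (0 : ℝ) < w' := by exact_mod_cast hw'
      have h3 : (p.2.card : ℝ) / w' ≤ 19 / 20 := by
        rw [div_le_div_iff₀ hwp (by norm_num)]
        have : (20 * p.2.card : ℝ) < 19 * w' := by exact_mod_cast h2
        linarith
      calc ((p.2.card : ℝ) / w') ^ (D * p.1.card) ≤ (19 / 20 : ℝ) ^ (D * p.1.card) :=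
            pow_le_pow_left₀ (by positivity) h3 _
        _ ≤ (19 / 20 : ℝ) ^ (60 * w) := by
            apply pow_le_pow_of_le_one (by norm_num) (by norm_num)
            nlinarith
        _ = ((19 / 20 : ℝ) ^ 60) ^ w := by rw [pow_mul]
        _ ≤ ((1 : ℝ) / 9) ^ w := by
            apply pow_le_pow_left₀ (by norm_num) (by norm_num)
    calc _ ≤ ∑ p ∈ S, ((1 : ℝ) / 9) ^ w := Finset.sum_le_sum hterm
      _ = S.card * ((1 : ℝ) / 9) ^ w := by rw [Finset.sum_const, nsmul_eq_mul]
      _ ≤ (8 : ℝ) ^ w * ((1 : ℝ) / 9) ^ w := by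
          gcongr
          have : S.card ≤ 8 ^ w := by
            calc S.card ≤ 2 ^ w * 2 ^ w' := by
                  refine (Finset.card_le_univ _).trans ?_
                  simp [Fintype.card_prod, Fintype.card_finset]
              _ ≤ 2 ^ w * 2 ^ (2 * w) := by gcongr; norm_num
              _ = 8 ^ w := by rw [← pow_add, show w + 2 * w = 3 * w by ring, pow_mul]; norm_num
          exact_mod_cast this
      _ = (8 / 9 : ℝ) ^ w := by rw [← mul_pow]; norm_num
      _ < 1 := pow_lt_one₀ (by norm_num) (by norm_num) hw.ne')
  refine ⟨f, fun X Y hXY hX => ?_⟩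
  by_contra hY
  exact hf (X, Y) (Finset.mem_filter.2 ⟨Finset.mem_univ _, hX, not_le.1 hY⟩) hXY
/-! ### The expanding gadget -/

/-- The expanding maps used for the construction (with `300` slots each). -/
structure GFns where
  fL : ℕ → ℕ → ℕ → ℕ
  fM : ℕ → ℕ → ℕ → ℕ
  fR : ℕ → ℕ → ℕ → ℕ
  hL : ∀ i d x, fL i d x < 2 ^ i
  hM : ∀ i d x, fM i d x < 2 ^ i
  hR : ∀ i d x, fR i d x < 2 ^ (i + 1)
  shrink : ∀ i, ∀ X Y : Finset ℕ, X ⊆ Finset.range (2 ^ (i + 1)) → Y ⊆ Finset.range (2 ^ i) →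
    (∀ x ∈ X, ∀ d < 300, fL i d x ∈ Y) → 2 * X.card ≤ 2 ^ i → X.card ≤ Y.card
  mixM : ∀ i, ∀ X Y : Finset ℕ, X ⊆ Finset.range (2 ^ i) → Y ⊆ Finset.range (2 ^ i) →
    (∀ x ∈ X, ∀ d < 300, fM i d x ∈ Y) → 2 ^ i ≤ 5 * X.card → 19 * 2 ^ i ≤ 20 * Y.card
  mixR : ∀ i, ∀ X Y : Finset ℕ, X ⊆ Finset.range (2 ^ i) → Y ⊆ Finset.range (2 ^ (i + 1)) →
    (∀ x ∈ X, ∀ d < 300, fR i d x ∈ Y) → 2 ^ i ≤ 5 * X.card → 19 * 2 ^ (i + 1) ≤ 20 * Y.card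

lemma fin_to_nat (D a b : ℕ) (hD : 0 < D) (ha : 0 < a) (g : Fin D → Fin a → Fin b) :
    ∃ f : ℕ → ℕ → ℕ, (∀ d x, f d x < b) ∧
      ∀ X Y : Finset ℕ, X ⊆ Finset.range a → Y ⊆ Finset.range b →
        (∀ x ∈ X, ∀ d < D, f d x ∈ Y) →
        ∃ (X' : Finset (Fin a)) (Y' : Finset (Fin b)), X'.card = X.card ∧ Y'.card = Y.card ∧
          ∀ x ∈ X', ∀ d, g d x ∈ Y' := by
  classical
  have key : ∀ (c : ℕ) (Z : Finset ℕ), Z ⊆ Finset.range c →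
      (Finset.univ.filter fun x : Fin c => x.1 ∈ Z).card = Z.card := by
    intro c Z hZ
    rw [← Finset.card_map Fin.valEmbedding]
    congr 1
    ext x
    simp only [Finset.mem_map, Finset.mem_filter, Finset.mem_univ, true_and, Fin.valEmbedding_apply]
    constructor
    · rintro ⟨y, hy, rfl⟩; exact hy
    · intro hx; exact ⟨⟨x, Finset.mem_range.1 (hZ hx)⟩, hx, rfl⟩
  refine ⟨fun d x => (g ⟨d % D, Nat.mod_lt _ hD⟩ ⟨x % a, Nat.mod_lt _ ha⟩).1,
    fun d x => (g _ _).2, fun X Y hX hY h => ⟨_, _, key a X hX, key b Y hY, ?_⟩⟩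
  intro x hx d
  simp only [Finset.mem_filter, Finset.mem_univ, true_and] at hx ⊢
  have := h x.1 hx d.1 d.2
  simpa [Nat.mod_eq_of_lt d.2, Nat.mod_eq_of_lt x.2] using this

lemma exists_gfns : Nonempty GFns := by
  have HL : ∀ i : ℕ, ∃ f : ℕ → ℕ → ℕ, (∀ d x, f d x < 2 ^ i) ∧
      ∀ X Y : Finset ℕ, X ⊆ Finset.range (2 ^ (i + 1)) → Y ⊆ Finset.range (2 ^ i) →
        (∀ x ∈ X, ∀ d < 300, f d x ∈ Y) → 2 * X.card ≤ 2 ^ i → X.card ≤ Y.card := by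
    intro i
    obtain ⟨g, hg⟩ := exists_shrink (2 ^ i) 300 (by positivity) (by norm_num)
    obtain ⟨f, h1, h2⟩ := fin_to_nat 300 (2 * 2 ^ i) (2 ^ i) (by norm_num) (by positivity) g
    refine ⟨f, h1, fun X Y hX hY h hc => ?_⟩
    rw [pow_succ'] at hX
    obtain ⟨X', Y', e1, e2, h3⟩ := h2 X Y hX hY h
    have := hg X' Y' h3 (by omega)
    omega
  have HMx : ∀ a b : ℕ, 0 < a → 0 < b → b ≤ 2 * a → ∃ f : ℕ → ℕ → ℕ, (∀ d x, f d x < b) ∧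
      ∀ X Y : Finset ℕ, X ⊆ Finset.range a → Y ⊆ Finset.range b →
        (∀ x ∈ X, ∀ d < 300, f d x ∈ Y) → a ≤ 5 * X.card → 19 * b ≤ 20 * Y.card := by
    intro a b ha hb hab
    obtain ⟨g, hg⟩ := exists_mix a b 300 ha hb hab le_rfl
    obtain ⟨f, h1, h2⟩ := fin_to_nat 300 a b (by norm_num) ha g
    refine ⟨f, h1, fun X Y hX hY h hc => ?_⟩
    obtain ⟨X', Y', e1, e2, h3⟩ := h2 X Y hX hY h
    have := hg X' Y' h3 (by omega)
    omega
  choose fL hL1 hL2 using HL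
  choose fM hM1 hM2 using fun i : ℕ => HMx (2 ^ i) (2 ^ i) (by positivity) (by positivity) (by omega)
  choose fR hR1 hR2 using fun i : ℕ => HMx (2 ^ i) (2 ^ (i + 1)) (by positivity) (by positivity)
    (by rw [pow_succ']) 
  exact ⟨⟨fL, fM, fR, hL1, hM1, hR1, hL2, hM2, hR2⟩⟩

lemma gadget (G : GFns) (t z : ℕ) (SL SR ZL ZR : ℕ → Finset ℕ)
    (hSL : ∀ i ≤ t, SL i ⊆ Finset.range (2 ^ i)) (hSR : ∀ i ≤ t, SR i ⊆ Finset.range (2 ^ i))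
    (h1 : ∀ i < t, ∀ x ∈ SL (i + 1) \ ZL (i + 1), ∀ d < 300, G.fL i d x ∈ SL i)
    (h2 : ∀ i ≤ t, ∀ x ∈ SL i \ ZL i, ∀ d < 300, G.fM i d x ∈ SR i)
    (h3 : ∀ i < t, ∀ x ∈ SR i \ ZR i, ∀ d < 300, G.fR i d x ∈ SR (i + 1))
    (hz : ∑ i ∈ Finset.range (t + 1), ((ZL i).card + (ZR i).card) ≤ z)
    (hbig : 11 * z + 1 ≤ (SL t).card) (hm : 2 * (11 * z + 1) ≤ 2 ^ t) :
    9 * 2 ^ t ≤ 10 * (SR t \ ZR t).card := by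
  classical
  have hex : ∃ i, 2 * (11 * z + 1) ≤ 2 ^ i := ⟨t, hm⟩
  obtain ⟨i0, hi0, hmin⟩ : ∃ i, 2 * (11 * z + 1) ≤ 2 ^ i ∧ ∀ j < i, 2 ^ j < 2 * (11 * z + 1) :=
    ⟨Nat.find hex, Nat.find_spec hex, fun j hj => not_le.1 (Nat.find_min hex hj)⟩
  have hi0t : i0 ≤ t := by
    by_contra hh
    have := hmin t (by omega)
    omega
  have hi0pos : 0 < i0 := by
    rcases Nat.eq_zero_or_pos i0 with h | h
    · rw [h] at hi0; simp at hi0; omega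
    · exact h
  have hup : 2 ^ i0 < 4 * (11 * z + 1) := by
    have := hmin (i0 - 1) (by omega)
    have e : 2 ^ i0 = 2 * 2 ^ (i0 - 1) := by rw [← pow_succ']; congr 1; omega
    omega
  have hpow : ∀ i, i0 ≤ i → 2 * (11 * z + 1) ≤ 2 ^ i := fun i hi =>
    hi0.trans (Nat.pow_le_pow_right (by norm_num) hi)
  have hsd : ∀ A B : Finset ℕ, A.card ≤ (A \ B).card + B.card := fun A B => by
    have := Finset.le_card_sdiff B A
    omega
  have hZR : ∀ i ≤ t, (ZR i).card ≤ z := by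
    intro i hi
    refine le_trans ?_ hz
    refine le_trans ?_ (Finset.single_le_sum (f := fun i => (ZL i).card + (ZR i).card)
      (fun _ _ => Nat.zero_le _) (Finset.mem_range.2 (by omega : i < t + 1)))
    exact Nat.le_add_left _ _
  have hZL : ∀ i, ∑ i' ∈ Finset.Ico i (t + 1), (ZL i').card ≤ z := by
    intro i
    refine le_trans ?_ hz
    calc _ ≤ ∑ i' ∈ Finset.Ico i (t + 1), ((ZL i').card + (ZR i').card) :=
          Finset.sum_le_sum fun _ _ => Nat.le_add_right _ _
      _ ≤ _ := Finset.sum_le_sum_of_subset (by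
          intro x hx; simp at hx ⊢; omega)
  -- down the left column
  have hdown : ∀ k, i0 + k ≤ t → 11 * z + 1 ≤ (SL (t - k) \ ZL (t - k)).card +
      ∑ i' ∈ Finset.Ico (t - k) (t + 1), (ZL i').card := by
    intro k
    induction k with
    | zero =>
      intro _
      have := hsd (SL t) (ZL t)
      simp only [Nat.sub_zero, Nat.Ico_succ_singleton, Finset.sum_singleton]
      omega
    | succ k ih =>
      intro hk
      have ih := ih (by omega)
      obtain ⟨i, hi⟩ : ∃ i, t = i + (k + 1) := ⟨t - (k + 1), by omega⟩
      have e1 : t - k = i + 1 := by omega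
      have e2 : t - (k + 1) = i := by omega
      rw [e1] at ih
      rw [e2]
      have hs : ∑ i' ∈ Finset.Ico i (t + 1), (ZL i').card =
          (ZL i).card + ∑ i' ∈ Finset.Ico (i + 1) (t + 1), (ZL i').card :=
        Finset.sum_eq_sum_Ico_succ_bot (by omega) _
      have hzl := hZL (i + 1)
      obtain ⟨X, hX, hXc⟩ := Finset.exists_subset_card_eq (s := SL (i + 1) \ ZL (i + 1))
        (n := 11 * z + 1 - ∑ i' ∈ Finset.Ico (i + 1) (t + 1), (ZL i').card) (by omega)
      have hp := hpow i (by omega)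
      have := G.shrink i X (SL i)
        (hX.trans (Finset.sdiff_subset.trans (hSL _ (by omega)))) (hSL _ (by omega))
        (fun x hx d hd => h1 i (by omega) x (hX hx) d hd) (by omega)
      have := hsd (SL i) (ZL i)
      omega
  have hL := hdown (t - i0) (by omega)
  have e : t - (t - i0) = i0 := by omega
  rw [e] at hL
  have hzl := hZL i0
  have hupc : ∀ k, i0 + k ≤ t →
      9 * 2 ^ (i0 + k) ≤ 10 * (SR (i0 + k) \ ZR (i0 + k)).card := by
    intro k
    induction k with
    | zero =>
      intro _
      have h5 := G.mixM i0 (SL i0 \ ZL i0) (SR i0) (Finset.sdiff_subset.trans (hSL _ hi0t))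
        (hSR _ hi0t) (h2 i0 hi0t) (by omega)
      have h6 := hsd (SR i0) (ZR i0)
      have h7 := hZR i0 hi0t
      simp only [Nat.add_zero]
      omega
    | succ k ih =>
      intro hk
      have ih := ih (by omega)
      have h5 := G.mixR (i0 + k) (SR (i0 + k) \ ZR (i0 + k)) (SR (i0 + k + 1))
        (Finset.sdiff_subset.trans (hSR _ (by omega)))
        (hSR _ (by omega)) (h3 (i0 + k) (by omega)) (by omega)
      have h6 := hsd (SR (i0 + k + 1)) (ZR (i0 + k + 1))
      have h7 := hZR (i0 + k + 1) (by omega)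
      have h8 := hpow (i0 + k + 1) (by omega)
      rw [← Nat.add_assoc]
      omega
  have := hupc (t - i0) (by omega)
  rwa [show i0 + (t - i0) = t by omega] at this
/-! ### The abstract time lower bound -/

lemma abstract_lower (T m B y : ℕ) (R : ℕ) (μ : ℕ → ℕ → ℕ → ℕ) (s : ℕ → ℕ → ℕ)
    (hy : 1 ≤ y) (hB : 1 ≤ B) (hm : 80 * (B * y) ≤ m)
    (f1 : ∀ j a b c, a ≤ b → b ≤ c → μ j a c ≤ μ j a b + μ j b c)
    (f2 : ∀ j a b, a ≤ b → b < T → μ j a (b + 1) ≤ μ j a b + 1)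
    (f3 : ∀ j a, μ j a a ≤ s j a)
    (f4 : ∀ j a b a' b', a ≤ a' → b' ≤ b → μ j a' b' ≤ μ j a b)
    (f5 : ∀ j t, t < T → s j (t + 1) ≤ s j t + 1)
    (F : ∀ j a b, j < R → a ≤ b → b ≤ T → 11 * s (j + 1) a + 1 ≤ μ (j + 1) a b →
      2 * (11 * s (j + 1) a + 1) ≤ m → m ≤ 2 * μ j a b) :
    ∀ j k a b, j ≤ R → k ≤ B → a ≤ b → b ≤ T → m ≤ 2 * μ j a b →
      (∀ t, a ≤ t → t ≤ b → ∑ i ∈ Finset.range (j + 1), s i t < k * y) →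
      B ^ (j - k) ≤ b - a := by
  -- discrete intermediate value
  have ivt : ∀ j a q n, a + n ≤ T → μ j a a ≤ q → q ≤ μ j a (a + n) →
      ∃ e, a ≤ e ∧ e ≤ a + n ∧ μ j a e = q := by
    intro j a q n
    induction n with
    | zero => intro _ h1 h2; exact ⟨a, le_rfl, by omega, le_antisymm h1 h2⟩
    | succ n ih =>
      intro hT h1 h2
      by_cases h : q ≤ μ j a (a + n)
      · obtain ⟨e, h3, h4, h5⟩ := ih (by omega) h1 h
        exact ⟨e, h3, by omega, h5⟩
      · have := f2 j a (a + n) (by omega) (by omega)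
        refine ⟨a + n + 1, by omega, by omega, ?_⟩
        have h2' : q ≤ μ j a (a + n + 1) := h2
        omega
  have hyB : y ≤ B * y := Nat.le_mul_of_pos_left y hB
  have hBy : B ≤ B * y := Nat.le_mul_of_pos_right B hy
  have base : ∀ j k a b, k ≤ B → a ≤ b → b ≤ T → m ≤ 2 * μ j a b →
      (∀ t, a ≤ t → t ≤ b → ∑ i ∈ Finset.range (j + 1), s i t < k * y) → 1 ≤ b - a := by
    intro j k a b hk hab hbT hμ hs
    by_contra hcon
    obtain rfl : a = b := by omega
    have h1 := hs a le_rfl le_rfl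
    have h2 : s j a ≤ ∑ i ∈ Finset.range (j + 1), s i a :=
      Finset.single_le_sum (f := fun i => s i a) (fun _ _ => Nat.zero_le _)
        (Finset.mem_range.2 (Nat.lt_succ_self j))
    have h3 := f3 j a
    have h4 : k * y ≤ B * y := Nat.mul_le_mul_right y hk
    omega
  intro j
  induction j with
  | zero =>
    intro k a b _ hk hab hbT hμ hs
    simpa using base 0 k a b hk hab hbT hμ hs
  | succ j ih =>
    intro k a b hjR hk hab hbT hμ hs
    rcases Nat.lt_or_ge k (j + 1) with hjk | hjk
    swap
    · rw [Nat.sub_eq_zero_of_le hjk, pow_zero]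
      exact base (j + 1) k a b hk hab hbT hμ hs
    rcases Nat.eq_zero_or_pos k with rfl | hkpos
    · have := hs a le_rfl hab
      omega
    have hky : k * y ≤ B * y := Nat.mul_le_mul_right y hk
    set P := B ^ (j - k) with hP
    have hpow : B ^ (j + 1 - k) = B * P := by
      rw [hP, ← pow_succ', show j + 1 - k = j - k + 1 by omega]
    -- high stretch
    have high : ∀ c d, a ≤ c → c ≤ d → d ≤ b → 11 * s (j + 1) c + 1 ≤ μ (j + 1) c d →
        (∀ t, c ≤ t → t ≤ d → y ≤ s (j + 1) t) → B * P ≤ d - c := by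
      intro c d hac hcd hdb hμc hst
      have hsc : s (j + 1) c < k * y := by
        have h1 := hs c hac (hcd.trans hdb)
        rw [Finset.sum_range_succ] at h1
        omega
      have h1 := F j c d (by omega) hcd (hdb.trans hbT) hμc (by omega)
      have h2 := ih (k - 1) c d (by omega) (by omega) hcd (hdb.trans hbT) h1 (by
        intro t ht1 ht2
        have h3 := hs t (hac.trans ht1) (ht2.trans hdb)
        rw [Finset.sum_range_succ] at h3
        have h4 := hst t ht1 ht2
        have h5 : (k - 1) * y + y = k * y := by
          rw [← Nat.succ_mul]; congr 1; omega
        omega)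
      rw [show j - (k - 1) = j + 1 - k by omega, hpow] at h2
      exact h2
    have low : ∀ c d, a ≤ c → c ≤ d → d ≤ b → 11 * s (j + 1) c + 1 ≤ μ (j + 1) c d →
        s (j + 1) c < y → P ≤ d - c := by
      intro c d hac hcd hdb hμc hst
      have h1 := F j c d (by omega) hcd (hdb.trans hbT) hμc (by omega)
      refine ih k c d (by omega) hk hcd (hdb.trans hbT) h1 ?_
      intro t ht1 ht2
      have h3 := hs t (hac.trans ht1) (ht2.trans hdb)
      rw [Finset.sum_range_succ] at h3
      omega
    rw [hpow]
    have rounds : ∀ ρ c, a ≤ c → c ≤ b → s (j + 1) c < y →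
        ρ * (2 * (11 * y + 1)) ≤ μ (j + 1) c b → B * P ≤ b - c ∨ ρ * P ≤ b - c := by
      intro ρ
      induction ρ with
      | zero => intro c _ _ _ _; right; simp
      | succ ρ ihρ =>
        intro c hac hcb hsc hμc
        have hμc' : ρ * (2 * (11 * y + 1)) + 2 * (11 * y + 1) ≤ μ (j + 1) c b := by
          rw [← Nat.succ_mul]; exact hμc
        obtain ⟨e, hce, heb, hμe⟩ := ivt (j + 1) c (11 * y + 1) (b - c) (by omega)
          (by have := f3 (j + 1) c; omega)
          (by rw [Nat.add_sub_cancel' hcb]; omega)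
        have heb' : e ≤ b := by omega
        have hl := low c e hac hce heb' (by omega) hsc
        have hsub := f1 (j + 1) c e b hce heb'
        -- excursion lemma
        have exc : ∀ d, e ≤ d → d ≤ b → (∀ t, e ≤ t → t ≤ d → y ≤ s (j + 1) t) →
            11 * y + 1 ≤ μ (j + 1) e d → B * P ≤ b - c := by
          intro d hed hdb hst hμd
          -- last low time before `e`
          have hlast : ∃ c0, c ≤ c0 ∧ c0 < e ∧ s (j + 1) c0 < y ∧
              ∀ t, c0 < t → t ≤ e → y ≤ s (j + 1) t := by
            have : ∀ n, ∀ e', e' = c + n → y ≤ s (j + 1) e' → ∃ c0, c ≤ c0 ∧ c0 < e' ∧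
                s (j + 1) c0 < y ∧ ∀ t, c0 < t → t ≤ e' → y ≤ s (j + 1) t := by
              intro n
              induction n with
              | zero => intro e' he' h; subst he'; exact absurd hsc (by simpa using h)
              | succ n ihn =>
                intro e' he' h
                by_cases hn : s (j + 1) (c + n) < y
                · refine ⟨c + n, by omega, by omega, hn, fun t h1 h2 => ?_⟩
                  obtain rfl : t = e' := by omega
                  exact h
                · obtain ⟨c0, h1, h2, h3, h4⟩ := ihn (c + n) rfl (not_lt.1 hn)
                  refine ⟨c0, h1, by omega, h3, fun t h5 h6 => ?_⟩
                  rcases Nat.lt_or_ge (c + n) t with h7 | h7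
                  · obtain rfl : t = e' := by omega
                    exact h
                  · exact h4 t h5 h7
            exact this (e - c) e (by omega) (hst e le_rfl hed)
          obtain ⟨c0, h1, h2, h3, h4⟩ := hlast
          have h5 := f5 (j + 1) c0 (by omega)
          have h6 := f4 (j + 1) (c0 + 1) d e d (by omega) le_rfl
          have h7 := high (c0 + 1) d (by omega) (by omega) hdb (by omega) (by
            intro t ht1 ht2
            rcases Nat.lt_or_ge t e with h | h
            · exact h4 t (by omega) h.le
            · exact hst t h ht2)
          omega
        by_cases hex : ∃ c', e ≤ c' ∧ c' ≤ b ∧ s (j + 1) c' < y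
        · classical
          let c' := Nat.find hex
          obtain ⟨h1, h2, h3⟩ : e ≤ c' ∧ c' ≤ b ∧ s (j + 1) c' < y := Nat.find_spec hex
          have hmin : ∀ t, e ≤ t → t < c' → y ≤ s (j + 1) t := by
            intro t ht1 ht2
            by_contra hcon
            exact Nat.find_min hex ht2 ⟨ht1, by omega, not_le.1 hcon⟩
          by_cases hbig : μ (j + 1) e c' ≤ 11 * y + 1
          · have hsub2 := f1 (j + 1) e c' b h1 h2
            rcases ihρ c' (by omega) h2 h3 (by omega) with h | h
            · left; omega
            · right; rw [Nat.succ_mul]; omega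
          · left
            have hne : e < c' := by
              rcases Nat.lt_or_ge e c' with h | h
              · exact h
              · have : e = c' := le_antisymm h1 h
                have h8 := f3 (j + 1) c'
                rw [this] at hbig
                omega
            have h9 := f2 (j + 1) e (c' - 1) (by omega) (by omega)
            rw [Nat.sub_add_cancel (by omega)] at h9
            exact exc (c' - 1) (by omega) (by omega)
              (fun t h1 h2 => hmin t h1 (by omega)) (by omega)
        · left
          push Not at hex
          exact exc b heb' le_rfl (fun t h1 h2 => hex t h1 h2) (by omega)
    have hsa : s (j + 1) a < k * y := by
      have h1 := hs a le_rfl hab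
      rw [Finset.sum_range_succ] at h1
      omega
    obtain ⟨d, had, hdb, hμd⟩ := ivt (j + 1) a (11 * (k * y) + 1) (b - a) (by omega)
      (by have := f3 (j + 1) a; omega)
      (by rw [Nat.add_sub_cancel' hab]; omega)
    by_cases hall : ∀ t, a ≤ t → t ≤ d → y ≤ s (j + 1) t
    · have := high a d le_rfl had (by omega) (by omega) hall
      omega
    · push Not at hall
      obtain ⟨a1, h1, h2, h3⟩ := hall
      have h4 := f4 (j + 1) a d a a1 le_rfl h2
      have h5 := f1 (j + 1) a a1 b h1 (by omega)
      have h6 : B * (2 * (11 * y + 1)) = 22 * (B * y) + 2 * B := by ring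
      rcases rounds B a1 h1 (by omega) h3 (by omega) with h | h <;> omega
/-! ### Reversible pebbling and Nullstellensatz -/

/-- Reversible pebbling: `Reach pd s T A B` means that configuration `B` can be reached from `A`
in at most `T` moves, with at most `s` pebbles after/before every move. -/
inductive Reach {V : Type} [DecidableEq V] (pd : V → Finset V) (s : ℕ) :
    ℕ → Finset V → Finset V → Prop
  | refl (A : Finset V) : Reach pd s 0 A A
  | idle {T : ℕ} {A B : Finset V} : Reach pd s T A B → Reach pd s (T + 1) A B
  | add {T : ℕ} {A B : Finset V} (v : V) : Reach pd s T A B → v ∉ B → pd v ⊆ B →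
      (insert v B).card ≤ s → Reach pd s (T + 1) A (insert v B)
  | del {T : ℕ} {A B : Finset V} (v : V) : Reach pd s T A (insert v B) → v ∉ B → pd v ⊆ B →
      (insert v B).card ≤ s → Reach pd s (T + 1) A B

/-- The clauses of the pebbling formula. -/
def pebClauses (N : ℕ) (pd : Fin N → Finset (Fin N)) (z : Fin N) : Finset (Clause N) :=
  insert (∅, {z}) (Finset.univ.image fun v => ({v}, pd v))

/-- The pebbling formula. -/
def pebCNF (N : ℕ) (pd : Fin N → Finset (Fin N)) (z : Fin N) : CNF where
  nvars := N
  clauses := pebClauses N pd z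

lemma pebCNF_card (N : ℕ) (pd : Fin N → Finset (Fin N)) (z : Fin N) :
    (pebCNF N pd z).clauses.card = N + 1 := by
  change (pebClauses N pd z).card = N + 1
  unfold pebClauses
  rw [Finset.card_insert_of_notMem, Finset.card_image_of_injective]
  · simp
  · intro v v' h
    simpa using (Prod.ext_iff.1 h).1
  · intro h
    obtain ⟨v, _, hv⟩ := Finset.mem_image.1 h
    have := (Prod.ext_iff.1 hv).1
    simp at this

lemma pebCNF_is3 (N : ℕ) (pd : Fin N → Finset (Fin N)) (z : Fin N)
    (h2 : ∀ v, (pd v).card ≤ 2) : (pebCNF N pd z).Is3CNF := by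
  intro C hC
  rcases Finset.mem_insert.1 hC with rfl | hC
  · change (∅ : Finset (Fin N)).card + ({z} : Finset (Fin N)).card ≤ 3
    simp
  · obtain ⟨v, _, rfl⟩ := Finset.mem_image.1 hC
    have := h2 v
    change ({v} : Finset (Fin N)).card + (pd v).card ≤ 3
    rw [Finset.card_singleton]
    omega

lemma pebCNF_unsat (N : ℕ) (pd : Fin N → Finset (Fin N)) (z : Fin N)
    (rk : Fin N → ℕ) (hrk : ∀ v, ∀ u ∈ pd v, rk u < rk v) : (pebCNF N pd z).Unsat := by
  intro a
  by_contra hcon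
  push Not at hcon
  change Fin N → Bool at a
  have hall : ∀ n, ∀ v : Fin N, rk v = n → a v = true := by
    intro n
    induction n using Nat.strong_induction_on with
    | _ n ih =>
      intro v hv
      rcases hcon ({v}, pd v) (Finset.mem_insert_of_mem
        (Finset.mem_image_of_mem _ (Finset.mem_univ v))) with ⟨x, hx, h⟩ | ⟨y, hy, h⟩
      · rw [Finset.mem_singleton.1 hx] at h; exact h
      · have := ih (rk y) (hv ▸ hrk v y hy) y rfl
        exact absurd (this.symm.trans h) (by simp)
  rcases hcon (∅, {z}) (Finset.mem_insert_self _ _) with ⟨x, hx, h⟩ | ⟨y, hy, h⟩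
  · simp at hx
  · exact absurd ((hall _ y rfl).symm.trans h) (by simp)

section NS

variable {N : ℕ} (F : Type) [Field F]

/-- The polynomials of the pebbling formula. -/
noncomputable def pp (pd : Fin N → Finset (Fin N)) (z : Fin N) :
    {C // C ∈ pebClauses N pd z} → MvPolynomial (Fin N) F :=
  fun C => Clause.poly F C.1

/-- The multilinear monomial of a set. -/
noncomputable def xs (A : Finset (Fin N)) : MvPolynomial (Fin N) F := ∏ v ∈ A, X v

lemma xs_eq_monomial (A : Finset (Fin N)) :
    xs F A = monomial (∑ v ∈ A, Finsupp.single v 1) (1 : F) := by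
  classical
  unfold xs
  induction A using Finset.induction_on with
  | empty => simp
  | insert v A hv ih =>
    rw [Finset.prod_insert hv, Finset.sum_insert hv, ih, X, monomial_mul, one_mul]

lemma xs_support (A : Finset (Fin N)) : (xs F A).support.card ≤ 1 := by
  rw [xs_eq_monomial]
  refine (Finset.card_le_card support_monomial_subset).trans ?_
  simp

lemma xs_deg (A : Finset (Fin N)) : (xs F A).totalDegree ≤ A.card := by
  unfold xs
  refine (totalDegree_finsetProd _ _).trans ?_
  simp [totalDegree_X]

lemma poly_support_le (v : Fin N) (P : Finset (Fin N)) :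
    (Clause.poly F (({v}, P) : Clause N)).support.card ≤ 2 := by
  classical
  have : Clause.poly F (({v}, P) : Clause N) = xs F P - X v * xs F P := by
    simp [Clause.poly, xs]; ring
  rw [this, sub_eq_add_neg]
  refine (Finset.card_le_card support_add).trans ((Finset.card_union_le _ _).trans ?_)
  have h1 := xs_support F P
  have h2 : (-(X v * xs F P)).support.card ≤ 1 := by
    rw [support_neg, xs_eq_monomial, X, monomial_mul]
    refine (Finset.card_le_card support_monomial_subset).trans ?_
    simp
  omega

/-- Index of a pebbling clause. -/
def pci (pd : Fin N → Finset (Fin N)) (z v : Fin N) : {C // C ∈ pebClauses N pd z} :=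
  ⟨({v}, pd v), Finset.mem_insert_of_mem (Finset.mem_image_of_mem _ (Finset.mem_univ v))⟩

/-- Index of the sink clause. -/
def sci (pd : Fin N → Finset (Fin N)) (z : Fin N) : {C // C ∈ pebClauses N pd z} :=
  ⟨(∅, {z}), Finset.mem_insert_self _ _⟩

lemma xs_step (pd : Fin N → Finset (Fin N)) (z v : Fin N) (B : Finset (Fin N)) (hv : v ∉ B)
    (hp : pd v ⊆ B) :
    xs F (B \ pd v) * pp F pd z (pci pd z v) = xs F B - xs F (insert v B) := by
  classical
  have h1 : xs F B = xs F (B \ pd v) * xs F (pd v) := (Finset.prod_sdiff hp).symm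
  have h2 : xs F (insert v B) = X v * xs F B := Finset.prod_insert hv
  rw [h2, h1]
  simp only [pp, pci, Clause.poly, Finset.prod_singleton]
  change xs F (B \ pd v) * ((1 - X v) * xs F (pd v)) = _
  ring

lemma update_step {ι σ : Type} [Fintype ι] [DecidableEq ι] (p r : ι → MvPolynomial σ F) (i : ι)
    (q : MvPolynomial σ F) (hq : q.support.card ≤ 1) (s c : ℕ)
    (hr : ∀ C, (r C * p C).totalDegree ≤ s) (hqs : (q * p i).totalDegree ≤ s)
    (hpi : (p i).support.card ≤ c) :
    ∑ C, (r + Pi.single i q : ι → MvPolynomial σ F) C * p C = ∑ C, r C * p C + q * p i ∧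
    (∀ C, ((r + Pi.single i q : ι → MvPolynomial σ F) C * p C).totalDegree ≤ s) ∧
    ∑ C, ((r + Pi.single i q : ι → MvPolynomial σ F) C).support.card * (p C).support.card
      ≤ ∑ C, (r C).support.card * (p C).support.card + c := by
  classical
  have h0 : ∀ C, (Pi.single i q : ι → MvPolynomial σ F) C = if C = i then q else 0 := by
    intro C; rw [Pi.single_apply]
  refine ⟨?_, ?_, ?_⟩
  · simp only [Pi.add_apply, add_mul, Finset.sum_add_distrib]
    simp [h0, ite_mul]
  · intro C
    simp only [Pi.add_apply, add_mul]
    refine (totalDegree_add _ _).trans (max_le (hr C) ?_)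
    rw [h0]
    split_ifs with h
    · rw [h]; exact hqs
    · simp
  · calc _ ≤ ∑ C, ((r C).support.card * (p C).support.card + if C = i then c else 0) := by
          refine Finset.sum_le_sum fun C _ => ?_
          rw [Pi.add_apply, h0]
          split_ifs with h
          · subst h
            have h1 : (r C + q).support.card ≤ (r C).support.card + 1 :=
              (Finset.card_le_card support_add).trans
                ((Finset.card_union_le _ _).trans (by omega))
            calc _ ≤ ((r C).support.card + 1) * (p C).support.card := Nat.mul_le_mul_right _ h1
              _ ≤ _ := by rw [Nat.succ_mul]; omega
          · simp
      _ = _ := by rw [Finset.sum_add_distrib]; simp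

lemma reach_derivation (pd : Fin N → Finset (Fin N)) (z : Fin N) {s T : ℕ}
    {A B : Finset (Fin N)} (h : Reach pd s T A B) :
    ∃ r : {C // C ∈ pebClauses N pd z} → MvPolynomial (Fin N) F,
      ∑ C, r C * pp F pd z C = xs F A - xs F B ∧
      (∀ C, (r C * pp F pd z C).totalDegree ≤ s) ∧
      ∑ C, (r C).support.card * (pp F pd z C).support.card ≤ 2 * T := by
  classical
  induction h with
  | refl A => exact ⟨0, by simp, by simp, by simp⟩
  | idle _ ih =>
    obtain ⟨r, h1, h2, h3⟩ := ih
    exact ⟨r, h1, h2, by omega⟩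
  | @add T A B v _ hv hp hs ih =>
    obtain ⟨r, h1, h2, h3⟩ := ih
    have hst := xs_step F pd z v B hv hp
    obtain ⟨g1, g2, g3⟩ := update_step F (pp F pd z) r (pci pd z v)
      (xs F (B \ pd v)) (xs_support F _) s 2 h2 (by
        rw [hst]
        refine (totalDegree_sub _ _).trans (max_le ((xs_deg F _).trans ?_) ((xs_deg F _).trans hs))
        exact (Finset.card_le_card (Finset.subset_insert _ _)).trans hs) (poly_support_le F _ _)
    refine ⟨_, ?_, g2, g3.trans (by omega)⟩
    rw [g1, h1, hst]; ring
  | @del T A B v _ hv hp hs ih =>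
    obtain ⟨r, h1, h2, h3⟩ := ih
    have hst := xs_step F pd z v B hv hp
    obtain ⟨g1, g2, g3⟩ := update_step F (pp F pd z) r (pci pd z v)
      (-xs F (B \ pd v)) (by rw [support_neg]; exact xs_support F _) s 2 h2 (by
        rw [neg_mul, totalDegree_neg, hst]
        refine (totalDegree_sub _ _).trans (max_le ((xs_deg F _).trans ?_) ((xs_deg F _).trans hs))
        exact (Finset.card_le_card (Finset.subset_insert _ _)).trans hs) (poly_support_le F _ _)
    refine ⟨_, ?_, g2, g3.trans (by omega)⟩
    rw [g1, h1, neg_mul, hst]; ring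

/-- A reversible pebbling gives a Nullstellensatz refutation. -/
lemma reach_cert (pd : Fin N → Finset (Fin N)) (z : Fin N) {s T : ℕ}
    {B : Finset (Fin N)} (h : Reach pd s T ∅ B) (hz : z ∈ B) (hB : B.card ≤ s) :
    ∃ r t, IsNSCert (pp F pd z) r t ∧
      nsDegree (pp F pd z) r t ≤ s ∧
      nsSize (pp F pd z) r t ≤ 2 * T + 1 := by
  classical
  obtain ⟨r, h1, h2, h3⟩ := reach_derivation F pd z h
  have hp : pp F pd z (sci pd z) = X z := by
    simp [pp, sci, Clause.poly]
  have hst : xs F (B.erase z) * pp F pd z (sci pd z) = xs F B := by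
    rw [hp]; exact Finset.prod_erase_mul _ _ hz
  obtain ⟨g1, g2, g3⟩ := update_step F (pp F pd z) r (sci pd z)
      (xs F (B.erase z)) (xs_support F _) s 1 h2 (by
        rw [hst]; exact (xs_deg F _).trans hB) (by
        rw [hp, X]
        refine (Finset.card_le_card support_monomial_subset).trans ?_
        simp)
  refine ⟨r + Pi.single (sci pd z) (xs F (B.erase z)), 0, ?_, ?_, ?_⟩
  rotate_left
  · unfold nsDegree
    refine max_le (Finset.sup_le fun C _ => g2 C) ?_
    simp
  · unfold nsSize
    refine le_trans (b := _ + 0) (Nat.add_le_add le_rfl (by simp)) ?_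
    rw [Nat.add_zero]
    exact g3.trans (by omega)
  · unfold IsNSCert
    have : ∑ j : Fin N, (0 : Fin N → MvPolynomial (Fin N) F) j * (X j ^ 2 - X j) = 0 := by simp
    refine (congrArg₂ (· + ·) g1 this).trans ?_
    rw [h1, hst]
    simp [xs]

end NS
/-! ### From Nullstellensatz refutations to pebblings -/

section NStoPeb

variable {N : ℕ} (F : Type) [Field F]

/-- Evaluation of the multilinearization at an indicator of a set of configurations. -/
noncomputable def funL (S : Finset (Fin N) → F) : MvPolynomial (Fin N) F →ₗ[F] F :=
  (MvPolynomial.basisMonomials (Fin N) F).constr F (fun e => S e.support)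

lemma funL_monomial (S : Finset (Fin N) → F) (e : Fin N →₀ ℕ) (a : F) :
    funL F S (monomial e a) = a * S e.support := by
  have h : monomial e a = a • (MvPolynomial.basisMonomials (Fin N) F) e := by
    rw [coe_basisMonomials, smul_monomial, smul_eq_mul, mul_one]
  rw [h, map_smul, funL, Module.Basis.constr_basis, smul_eq_mul]

lemma funL_mul_monomial (S : Finset (Fin N) → F) (q p : MvPolynomial (Fin N) F)
    (h : ∀ e ∈ q.support, funL F S (monomial e 1 * p) = 0) : funL F S (q * p) = 0 := by
  conv_lhs => rw [q.as_sum]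
  rw [Finset.sum_mul, map_sum]
  refine Finset.sum_eq_zero fun e he => ?_
  have : monomial e (coeff e q) = coeff e q • monomial e (1 : F) := by
    rw [smul_monomial, smul_eq_mul, mul_one]
  rw [this, smul_mul_assoc, map_smul, h e he, smul_zero]

lemma supp_add_single (e : Fin N →₀ ℕ) (v : Fin N) (k : ℕ) (hk : k ≠ 0) :
    (e + Finsupp.single v k).support = insert v e.support := by
  ext u
  simp only [Finsupp.mem_support_iff, Finsupp.add_apply, Finset.mem_insert, Finsupp.single_apply]
  by_cases h : v = u
  · simp [h, hk]
  · simp [h, Ne.symm h]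

lemma supp_add_sum (e : Fin N →₀ ℕ) (A : Finset (Fin N)) :
    (e + ∑ v ∈ A, Finsupp.single v 1).support = e.support ∪ A := by
  induction A using Finset.induction_on with
  | empty => simp
  | insert v A hv ih =>
    rw [Finset.sum_insert hv, add_comm (Finsupp.single v 1), ← add_assoc,
      supp_add_single _ _ _ one_ne_zero, ih, Finset.union_insert]

lemma funL_bool (S : Finset (Fin N) → F) (q : MvPolynomial (Fin N) F) (j : Fin N) :
    funL F S (q * (X j ^ 2 - X j)) = 0 := by
  refine funL_mul_monomial F S _ _ fun e _ => ?_
  have h1 : monomial e (1 : F) * X j ^ 2 = monomial (e + Finsupp.single j 2) 1 := by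
    rw [X_pow_eq_monomial, monomial_mul, one_mul]
  have h2 : monomial e (1 : F) * X j = monomial (e + Finsupp.single j 1) 1 := by
    rw [X, monomial_mul, one_mul]
  rw [mul_sub, h1, h2, map_sub, funL_monomial, funL_monomial,
    supp_add_single _ _ _ two_ne_zero, supp_add_single _ _ _ one_ne_zero, sub_self]

lemma funL_peb (S : Finset (Fin N) → F) (e : Fin N →₀ ℕ) (v : Fin N) (P : Finset (Fin N)) :
    funL F S (monomial e 1 * ((1 - X v) * xs F P)) =
      S (e.support ∪ P) - S (insert v (e.support ∪ P)) := by
  have h1 : monomial e (1 : F) * ((1 - X v) * xs F P) =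
      monomial (e + ∑ v ∈ P, Finsupp.single v 1) 1 -
      monomial (e + ∑ v ∈ P, Finsupp.single v 1 + Finsupp.single v 1) 1 := by
    have : monomial (e + ∑ v ∈ P, Finsupp.single v 1 + Finsupp.single v 1) (1 : F) =
        monomial e 1 * xs F P * X v := by
      rw [xs_eq_monomial, X, monomial_mul, monomial_mul, one_mul, one_mul]
    rw [this]
    have : monomial (e + ∑ v ∈ P, Finsupp.single v 1) (1 : F) =
        monomial e 1 * xs F P := by
      rw [xs_eq_monomial, monomial_mul, one_mul]
    rw [this]; ring
  rw [h1, map_sub, funL_monomial, funL_monomial, supp_add_single _ _ _ one_ne_zero,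
    supp_add_sum, one_mul, one_mul]

lemma one_sub_X_ne (v : Fin N) : (1 - X v : MvPolynomial (Fin N) F) ≠ 0 := by
  intro h
  have := congrArg (MvPolynomial.eval (0 : Fin N → F)) h
  simp at this

lemma one_sub_X_deg (v : Fin N) : 1 ≤ (1 - X v : MvPolynomial (Fin N) F).totalDegree := by
  by_contra h
  have h0 : (1 - X v : MvPolynomial (Fin N) F).totalDegree = 0 := by omega
  rw [totalDegree_eq_zero_iff_eq_C] at h0
  have h1 := congrArg (MvPolynomial.eval (0 : Fin N → F)) h0
  have h2 := congrArg (MvPolynomial.eval (1 : Fin N → F)) h0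
  simp only [eval_C] at h1 h2
  have := h1.trans h2.symm
  simp at this

lemma xs_ne (A : Finset (Fin N)) : xs F A ≠ 0 := by
  rw [xs_eq_monomial]
  simp

lemma xs_deg_eq (A : Finset (Fin N)) : A.card ≤ (xs F A).totalDegree := by
  rw [xs_eq_monomial, totalDegree_monomial _ one_ne_zero]
  have : A.card = (∑ v ∈ A, Finsupp.single v 1 : Fin N →₀ ℕ).degree := by
    rw [map_sum]; simp
  rw [this]; rfl

lemma supp_card_le_deg (q : MvPolynomial (Fin N) F) (e : Fin N →₀ ℕ) (he : e ∈ q.support) :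
    e.support.card ≤ q.totalDegree := by
  refine le_trans ?_ (le_totalDegree he)
  rw [Finsupp.sum, Finset.card_eq_sum_ones]
  refine Finset.sum_le_sum fun i hi => ?_
  have := Finsupp.mem_support_iff.1 hi
  omega

lemma sum_inj_le {α β : Type} [Fintype α] [Fintype β] (g : α → β) (hg : Function.Injective g)
    (f : β → ℕ) : ∑ a, f (g a) ≤ ∑ b, f b := by
  classical
  rw [← Finset.sum_image (s := Finset.univ) (g := g) (f := f) (fun a _ b _ hab => hg hab)]
  exact Finset.sum_le_sum_of_subset (Finset.subset_univ _)

set_option maxHeartbeats 1000000 in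
/-- A walk in configuration space extracted from a refutation. -/
lemma ns_trajectory (pd : Fin N → Finset (Fin N)) (z : Fin N)
    (r : {C // C ∈ pebClauses N pd z} → MvPolynomial (Fin N) F)
    (s : Fin N → MvPolynomial (Fin N) F) (h : IsNSCert (pp F pd z) r s) :
    ∃ (T : ℕ) (A : ℕ → Finset (Fin N)), T ≤ nsSize (pp F pd z) r s ∧ A 0 = ∅ ∧ z ∈ A T ∧
      (∀ t ≤ T, (A t).card ≤ nsDegree (pp F pd z) r s) ∧
      ∀ t < T, ∃ v, (A (t + 1) = insert v (A t) ∨ A t = insert v (A (t + 1))) ∧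
        pd v ⊆ A t ∧ pd v ⊆ A (t + 1) := by
  classical
  let rel : Finset (Fin N) → Finset (Fin N) → Prop := fun A B =>
    ∃ v, ∃ e ∈ (r (pci pd z v)).support, A = e.support ∪ pd v ∧ B = insert v A
  let G : SimpleGraph (Finset (Fin N)) := SimpleGraph.fromRel rel
  have hppv : ∀ v, pp F pd z (pci pd z v) = (1 - X v) * xs F (pd v) := by
    intro v; simp [pp, pci, Clause.poly, xs]
  have hpps : pp F pd z (sci pd z) = X z := by
    simp [pp, sci, Clause.poly]
  have hcases : ∀ C, C = sci pd z ∨ ∃ v, C = pci pd z v := by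
    intro C
    rcases Finset.mem_insert.1 C.2 with h | h
    · exact Or.inl (Subtype.ext h)
    · obtain ⟨v, _, hv⟩ := Finset.mem_image.1 h
      exact Or.inr ⟨v, Subtype.ext hv.symm⟩
  have hex : ∃ A, z ∈ A ∧ G.Reachable ∅ A := by
    by_contra hno
    push Not at hno
    let S : Finset (Fin N) → F := fun A => if G.Reachable ∅ A then 1 else 0
    have hL := congrArg (funL F S) h
    have h1 : funL F S 1 = 1 := by
      have : (1 : MvPolynomial (Fin N) F) = monomial 0 1 := rfl
      rw [this, funL_monomial]
      simp [S]
    rw [map_add, map_sum, map_sum, h1] at hL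
    rw [Finset.sum_eq_zero, Finset.sum_eq_zero, add_zero] at hL
    · exact zero_ne_one hL
    · intro j _; exact funL_bool F S _ j
    · intro C _
      refine funL_mul_monomial F S _ _ fun e he => ?_
      rcases hcases C with rfl | ⟨v, rfl⟩
      · rw [hpps, X, monomial_mul, funL_monomial, supp_add_single _ _ _ one_ne_zero]
        have : ¬ G.Reachable ∅ (insert z e.support) := hno _ (Finset.mem_insert_self _ _)
        simp [S, this]
      · rw [hppv, funL_peb]
        by_cases hne : e.support ∪ pd v = insert v (e.support ∪ pd v)
        · rw [← hne, sub_self]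
        · have hadj : G.Adj (e.support ∪ pd v) (insert v (e.support ∪ pd v)) := by
            rw [SimpleGraph.fromRel_adj]
            exact ⟨hne, Or.inl ⟨v, e, he, rfl, rfl⟩⟩
          have : G.Reachable ∅ (e.support ∪ pd v) ↔
              G.Reachable ∅ (insert v (e.support ∪ pd v)) :=
            ⟨fun g => g.trans hadj.reachable, fun g => g.trans hadj.symm.reachable⟩
          simp only [S, this, sub_self]
  obtain ⟨A, hzA, ⟨w⟩⟩ := hex
  let p := w.toPath
  have hdeg : ∀ v, ∀ e ∈ (r (pci pd z v)).support,
      (insert v (e.support ∪ pd v)).card ≤ nsDegree (pp F pd z) r s := by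
    intro v e he
    have hr0 : r (pci pd z v) ≠ 0 := by
      intro h0; rw [h0] at he; simp at he
    have h1 : (r (pci pd z v) * pp F pd z (pci pd z v)).totalDegree ≤
        nsDegree (pp F pd z) r s :=
      le_max_of_le_left (Finset.le_sup (f := fun i => (r i * pp F pd z i).totalDegree)
        (Finset.mem_univ (pci pd z v)))
    rw [hppv, totalDegree_mul_of_isDomain hr0 (mul_ne_zero (one_sub_X_ne F v) (xs_ne F _)),
      totalDegree_mul_of_isDomain (one_sub_X_ne F v) (xs_ne F _)] at h1
    have h2 := one_sub_X_deg F v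
    have h3 := xs_deg_eq F (pd v)
    have h4 := supp_card_le_deg F _ e he
    have h5 := Finset.card_insert_le v (e.support ∪ pd v)
    have h6 := Finset.card_union_le e.support (pd v)
    omega
  have hadjdeg : ∀ A B, G.Adj A B → B.card ≤ nsDegree (pp F pd z) r s := by
    intro A B hAB
    rw [SimpleGraph.fromRel_adj] at hAB
    rcases hAB with ⟨_, ⟨v, e, he, rfl, rfl⟩ | ⟨v, e, he, rfl, rfl⟩⟩
    · exact hdeg v e he
    · exact (Finset.card_le_card (Finset.subset_insert _ _)).trans (hdeg v e he)
  refine ⟨p.1.length, p.1.getVert, ?_, by simp, by simpa using hzA, ?_, ?_⟩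
  · have hnd := p.2.isTrail.edges_nodup
    have hsub : p.1.edges.toFinset ⊆
        (Finset.univ.sigma fun v => (r (pci pd z v)).support).image
          (fun x => s(x.2.support ∪ pd x.1, insert x.1 (x.2.support ∪ pd x.1))) := by
      intro ed hed
      rw [List.mem_toFinset] at hed
      have hE := p.1.edges_subset_edgeSet hed
      induction ed using Sym2.ind with
      | _ A B =>
        rw [SimpleGraph.mem_edgeSet, SimpleGraph.fromRel_adj] at hE
        rw [Finset.mem_image]
        rcases hE with ⟨_, ⟨v, e, he, rfl, rfl⟩ | ⟨v, e, he, rfl, rfl⟩⟩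
        · exact ⟨⟨v, e⟩, by simpa using he, rfl⟩
        · exact ⟨⟨v, e⟩, by simpa using he, Sym2.eq_swap⟩
    have hc := (Finset.card_le_card hsub).trans Finset.card_image_le
    rw [List.toFinset_card_of_nodup hnd, SimpleGraph.Walk.length_edges, Finset.card_sigma] at hc
    refine hc.trans ?_
    unfold nsSize
    refine le_add_right ?_
    have hinj : Function.Injective (pci pd z) := by
      intro v v' hv
      have := (Prod.ext_iff.1 (Subtype.ext_iff.1 hv)).1
      simpa [pci] using this
    calc ∑ v, (r (pci pd z v)).support.card
        ≤ ∑ v, (r (pci pd z v)).support.card * (pp F pd z (pci pd z v)).support.card := by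
          refine Finset.sum_le_sum fun v _ => Nat.le_mul_of_pos_right _ ?_
          rw [Finset.card_pos, support_nonempty, hppv]
          exact mul_ne_zero (one_sub_X_ne F v) (xs_ne F _)
      _ ≤ _ := sum_inj_le (pci pd z) hinj
          (fun C => (r C).support.card * (pp F pd z C).support.card)
  · intro t ht
    rcases t with _ | t
    · simp
    · exact hadjdeg _ _ (p.1.adj_getVert_succ (by omega))
  · intro t ht
    have := p.1.adj_getVert_succ ht
    rw [SimpleGraph.fromRel_adj] at this
    rcases this with ⟨_, ⟨v, e, he, h1, h2⟩ | ⟨v, e, he, h1, h2⟩⟩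
    · refine ⟨v, Or.inl h2, ?_, ?_⟩
      · rw [h1]; exact Finset.subset_union_right
      · rw [h2, h1]; exact Finset.subset_union_right.trans (Finset.subset_insert _ _)
    · refine ⟨v, Or.inr h2, ?_, ?_⟩
      · rw [h2, h1]; exact Finset.subset_union_right.trans (Finset.subset_insert _ _)
      · rw [h1]; exact Finset.subset_union_right

end NStoPeb
/-! ### Upper bounds for reversible pebbling -/

section ReachLemmas

variable {V : Type} [DecidableEq V] {pd : V → Finset V}

lemma Reach.monoS {s s' T : ℕ} {A B : Finset V} (h : Reach pd s T A B) (hs : s ≤ s') :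
    Reach pd s' T A B := by
  induction h with
  | refl A => exact .refl A
  | idle _ ih => exact .idle ih
  | add v _ hv hp hc ih => exact .add v ih hv hp (hc.trans hs)
  | del v _ hv hp hc ih => exact .del v ih hv hp (hc.trans hs)

lemma Reach.addT {s T : ℕ} {A B : Finset V} (h : Reach pd s T A B) (k : ℕ) :
    Reach pd s (T + k) A B := by
  induction k with
  | zero => exact h
  | succ k ih => exact .idle ih

lemma Reach.monoT {s T T' : ℕ} {A B : Finset V} (h : Reach pd s T A B) (hT : T ≤ T') :
    Reach pd s T' A B := by
  obtain ⟨k, rfl⟩ := Nat.exists_eq_add_of_le hT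
  exact h.addT k

lemma Reach.trans {s T T' : ℕ} {A B C : Finset V} (h : Reach pd s T A B)
    (h' : Reach pd s T' B C) : Reach pd s (T + T') A C := by
  induction h' with
  | refl A => exact h
  | idle _ ih => exact .idle (ih h)
  | add v _ hv hp hc ih => exact .add v (ih h) hv hp hc
  | del v _ hv hp hc ih => exact .del v (ih h) hv hp hc

lemma Reach.symm {s T : ℕ} {A B : Finset V} (h : Reach pd s T A B) : Reach pd s T B A := by
  induction h with
  | refl A => exact .refl A
  | idle _ ih => exact .idle ih
  | add v _ hv hp hc ih =>
    have := (Reach.del (s := s) v (.refl _) hv hp hc).trans ih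
    exact this.monoT (by omega)
  | del v _ hv hp hc ih =>
    have := (Reach.add (s := s) v (.refl _) hv hp hc).trans ih
    exact this.monoT (by omega)

lemma Reach.frame {s T c : ℕ} {A B : Finset V} (h : Reach pd s T A B) (C : Finset V)
    (hC : C.card ≤ c) : Reach pd (s + c) T (A ∪ C) (B ∪ C) := by
  induction h with
  | refl A => exact .refl _
  | idle _ ih => exact .idle ih
  | @add T A B v _ hv hp hc ih =>
    rw [Finset.insert_union]
    by_cases hvC : v ∈ C
    · rw [Finset.insert_eq_of_mem (Finset.mem_union_right _ hvC)]
      exact .idle ih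
    · refine .add v ih (by simp [hv, hvC]) (hp.trans Finset.subset_union_left) ?_
      rw [← Finset.insert_union]
      exact (Finset.card_union_le _ _).trans (by omega)
  | @del T A B v _ hv hp hc ih =>
    rw [Finset.insert_union] at ih
    by_cases hvC : v ∈ C
    · rw [Finset.insert_eq_of_mem (Finset.mem_union_right _ hvC)] at ih
      exact .idle ih
    · refine .del v ih (by simp [hv, hvC]) (hp.trans Finset.subset_union_left) ?_
      rw [← Finset.insert_union]
      exact (Finset.card_union_le _ _).trans (by omega)

lemma Reach.map {W : Type} [DecidableEq W] (e : V ≃ W) {pdW : W → Finset W}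
    (hpd : ∀ v, pdW (e v) = (pd v).map e.toEmbedding) {s T : ℕ} {A B : Finset V}
    (h : Reach pd s T A B) :
    Reach pdW s T (A.map e.toEmbedding) (B.map e.toEmbedding) := by
  induction h with
  | refl A => exact .refl _
  | idle _ ih => exact .idle ih
  | @add T A B v _ hv hp hc ih =>
    have hc' : (insert (e v) (B.map e.toEmbedding)).card ≤ s := by
      have := Finset.map_insert e.toEmbedding v B
      rw [Equiv.coe_toEmbedding] at this
      rw [← this, Finset.card_map]; exact hc
    rw [Finset.map_insert]
    refine .add (e v) ih (by simpa using hv) ?_ hc'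
    rw [hpd]; exact Finset.map_subset_map.2 hp
  | @del T A B v _ hv hp hc ih =>
    have hc' : (insert (e v) (B.map e.toEmbedding)).card ≤ s := by
      have := Finset.map_insert e.toEmbedding v B
      rw [Equiv.coe_toEmbedding] at this
      rw [← this, Finset.card_map]; exact hc
    rw [Finset.map_insert] at ih
    refine .del (e v) ih (by simpa using hv) ?_ hc'
    rw [hpd]; exact Finset.map_subset_map.2 hp

lemma reach_set {s : ℕ} (P : Finset V) (h : ∀ u ∈ P, ∃ T, Reach pd s T ∅ {u}) :
    ∃ T, Reach pd (s + P.card) T ∅ P := by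
  induction P using Finset.induction_on with
  | empty => exact ⟨0, .refl _⟩
  | insert v P hv ih =>
    obtain ⟨T, hT⟩ := ih fun u hu => h u (Finset.mem_insert_of_mem hu)
    obtain ⟨T', hT'⟩ := h v (Finset.mem_insert_self _ _)
    have h1 := hT'.frame P le_rfl
    rw [Finset.empty_union, ← Finset.insert_eq] at h1
    have hc := Finset.card_insert_of_notMem hv
    exact ⟨_, (hT.monoS (by omega)).trans (h1.monoS (by omega))⟩

lemma reach_depth (rk : V → ℕ) (hrk : ∀ v, ∀ u ∈ pd v, rk u < rk v)
    (h2 : ∀ v, (pd v).card ≤ 2) (h : ℕ) :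
    ∀ v, rk v ≤ h → ∃ T, Reach pd (3 * h + 3) T ∅ {v} := by
  induction h using Nat.strong_induction_on with
  | _ h ih =>
    intro v hv
    rcases Nat.eq_zero_or_pos h with rfl | hpos
    · have hp : pd v = ∅ := by
        rw [Finset.eq_empty_iff_forall_notMem]
        intro u hu
        have := hrk v u hu
        omega
      refine ⟨1, ?_⟩
      have := Reach.add (s := 3) (pd := pd) v (.refl ∅) (by simp) (by rw [hp]) (by simp)
      simpa using this
    · obtain ⟨T, hT⟩ := reach_set (s := 3 * (h - 1) + 3) (pd v) (fun u hu => ih (h - 1) (by omega) u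
        (by have := hrk v u hu; omega))
      have hc := h2 v
      have hvn : v ∉ pd v := fun hvv => lt_irrefl _ (hrk v v hvv)
      have h3 := hT.symm.frame {v} (c := 1) (by simp)
      rw [Finset.empty_union, Finset.union_comm, ← Finset.insert_eq] at h3
      have hci := Finset.card_insert_of_notMem hvn
      have h4 := Reach.add (s := 3 * h + 3) v (hT.monoS (by omega)) hvn (by rfl) (by omega)
      exact ⟨_, h4.trans (h3.monoS (by omega))⟩

lemma reach_topo (rk : V → ℕ) (hrk : ∀ v, ∀ u ∈ pd v, rk u < rk v) (B : Finset V) (n : ℕ) :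
    ∀ S : Finset V, S.card = n → (∀ v ∈ S, pd v ⊆ B ∪ S) →
      Reach pd (B ∪ S).card n B (B ∪ S) := by
  induction n with
  | zero =>
    intro S hS _
    rw [Finset.card_eq_zero.1 hS, Finset.union_empty]
    exact .refl _
  | succ n ih =>
    intro S hS hp
    obtain ⟨v, hv, hmax⟩ := Finset.exists_max_image S rk (Finset.card_pos.1 (by omega))
    have hsub : ∀ u ∈ S, pd u ⊆ B ∪ S.erase v := by
      intro u hu x hx
      have h1 := hp u hu hx
      have h2 := hrk u x hx
      have h3 := hmax u hu
      have hne : x ≠ v := by rintro rfl; omega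
      rw [Finset.mem_union] at h1 ⊢
      exact h1.imp id fun h => Finset.mem_erase.2 ⟨hne, h⟩
    have h1 := ih (S.erase v) (by rw [Finset.card_erase_of_mem hv]; omega)
      (fun u hu => hsub u (Finset.mem_of_mem_erase hu))
    have hins : insert v (B ∪ S.erase v) = B ∪ S := by
      rw [← Finset.union_insert, Finset.insert_erase hv]
    have h1' := h1.monoS (s' := (B ∪ S).card) (Finset.card_le_card
      (Finset.union_subset_union_right (Finset.erase_subset _ _)))
    by_cases hvB : v ∈ B
    · rw [Finset.insert_eq_of_mem (Finset.mem_union_left _ hvB)] at hins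
      rw [hins] at h1'
      exact .idle h1'
    · have := Reach.add v h1' (by simp [hvB]) (hsub v hv) (by rw [hins])
      rwa [hins] at this

lemma reach_chain {s τ w : ℕ} (Wi : ℕ → Finset V) (hw : ∀ i, (Wi i).card ≤ w)
    (H : ∀ i, Reach pd s τ (Wi i) (Wi i ∪ Wi (i + 1))) (q : ℕ) :
    Reach pd (s + q * w) (q * τ) (Wi 0) ((Finset.range (q + 1)).biUnion Wi) := by
  induction q with
  | zero =>
    simp only [zero_add, Finset.range_one, Finset.singleton_biUnion, Nat.zero_mul]
    exact .refl _
  | succ q ih =>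
    have hc : ((Finset.range q).biUnion Wi).card ≤ q * w := by
      have := Finset.card_biUnion_le_card_mul (Finset.range q) Wi w (fun i _ => hw i)
      simpa using this
    have h1 := (H q).frame _ hc
    have e1 : (Finset.range (q + 1)).biUnion Wi = Wi q ∪ (Finset.range q).biUnion Wi := by
      rw [Finset.range_add_one, Finset.biUnion_insert]
    have e2 : (Finset.range (q + 1 + 1)).biUnion Wi =
        Wi q ∪ Wi (q + 1) ∪ (Finset.range q).biUnion Wi := by
      rw [Finset.range_add_one, Finset.biUnion_insert, e1, ← Finset.union_assoc,
        Finset.union_comm (Wi (q + 1))]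
    rw [e2]
    rw [e1] at ih
    rw [Nat.succ_mul, Nat.succ_mul]
    exact (ih.monoS (by omega)).trans (h1.monoS (by omega))

lemma reach_line {w l : ℕ} (W : ℕ → Finset V) (hw : ∀ i, (W i).card ≤ w)
    (H : ∀ i, Reach pd (2 * w) w (W i) (W i ∪ W (i + 1))) (k : ℕ) :
    ∀ j, Reach pd ((k * (l + 1) + 2) * w) ((2 * (l + 1)) ^ k * w) (W j)
      (W j ∪ W (j + (l + 1) ^ k)) := by
  induction k with
  | zero => intro j; simpa using H j
  | succ k ih =>
    intro j
    let Wi : ℕ → Finset V := fun i => W (j + i * (l + 1) ^ k)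
    have hWi : ∀ i, (Wi i).card ≤ w := fun i => hw _
    have HWi : ∀ i, Reach pd ((k * (l + 1) + 2) * w) ((2 * (l + 1)) ^ k * w) (Wi i)
        (Wi i ∪ Wi (i + 1)) := by
      intro i
      have := ih (j + i * (l + 1) ^ k)
      have e : j + (i + 1) * (l + 1) ^ k = j + i * (l + 1) ^ k + (l + 1) ^ k := by ring
      simp only [Wi, e]
      exact this
    have h1 := reach_chain Wi hWi HWi (l + 1)
    have h2 := (reach_chain Wi hWi HWi l).symm.frame (Wi (l + 1)) (hWi _)
    have e1 : (Finset.range (l + 1 + 1)).biUnion Wi =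
        (Finset.range (l + 1)).biUnion Wi ∪ Wi (l + 1) := by
      rw [Finset.range_add_one, Finset.biUnion_insert, Finset.union_comm]
    rw [e1] at h1
    have e3 : Wi 0 = W j := by simp [Wi]
    have e4 : Wi (l + 1) = W (j + (l + 1) ^ (k + 1)) := by
      simp only [Wi]; congr 1; ring
    rw [e3, e4] at h2
    rw [e3, e4] at h1
    have hs : (k * (l + 1) + 2) * w + (l + 1) * w = ((k + 1) * (l + 1) + 2) * w := by ring
    have hs2 : (k * (l + 1) + 2) * w + l * w + w = ((k + 1) * (l + 1) + 2) * w := by ring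
    have ht : (l + 1) * ((2 * (l + 1)) ^ k * w) + l * ((2 * (l + 1)) ^ k * w) ≤
        (2 * (l + 1)) ^ (k + 1) * w := by
      have : (2 * (l + 1)) ^ (k + 1) * w = (l + 1) * ((2 * (l + 1)) ^ k * w) +
        l * ((2 * (l + 1)) ^ k * w) + (2 * (l + 1)) ^ k * w := by ring
      omega
    rw [hs] at h1
    rw [hs2] at h2
    exact (h1.trans h2).monoT ht

/-- Bennett-style pebbling of a layered graph. -/
lemma reach_layers (rk : V → ℕ) (hrk : ∀ v, ∀ u ∈ pd v, rk u < rk v) (w l k r : ℕ)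
    (W : ℕ → Finset V) (hw : ∀ i, (W i).card ≤ w)
    (h0 : ∀ v ∈ W 0, pd v ⊆ W 0)
    (hS : ∀ i < r, ∀ v ∈ W (i + 1), pd v ⊆ W i ∪ W (i + 1)) (hr : r ≤ (l + 1) ^ k) :
    ∃ B, W r ⊆ B ∧ B.card ≤ (k * (l + 1) + 2) * w ∧
      Reach pd ((k * (l + 1) + 2) * w) (w + (2 * (l + 1)) ^ k * w) ∅ B := by
  let W' : ℕ → Finset V := fun j => W (min j r)
  have hw' : ∀ i, (W' i).card ≤ w := fun i => hw _
  have H : ∀ i, Reach pd (2 * w) w (W' i) (W' i ∪ W' (i + 1)) := by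
    intro i
    rcases Nat.lt_or_ge i r with hi | hi
    · have e1 : W' i = W i := by simp only [W']; congr 1; omega
      have e2 : W' (i + 1) = W (i + 1) := by simp only [W']; congr 1; omega
      rw [e1, e2]
      have := reach_topo rk hrk (W i) _ (W (i + 1)) rfl (hS i hi)
      refine (this.monoS ((Finset.card_union_le _ _).trans ?_)).monoT (hw _)
      have h1 := hw i
      have h2 := hw (i + 1)
      omega
    · have e1 : W' (i + 1) = W' i := by simp only [W']; congr 1; omega
      rw [e1, Finset.union_self]
      exact (Reach.refl _).monoT (Nat.zero_le _)
  have h1 := reach_line (l := l) W' hw' H k 0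
  have e0 : W' 0 = W 0 := by simp [W']
  have er : W' (0 + (l + 1) ^ k) = W r := by simp only [W']; congr 1; omega
  rw [e0, er] at h1
  have h2 := reach_topo rk hrk ∅ _ (W 0) rfl (by simpa using h0)
  rw [Finset.empty_union] at h2
  have hsp : 2 * w ≤ (k * (l + 1) + 2) * w := Nat.mul_le_mul_right _ (by omega)
  have hw0 := hw 0
  have hwr := hw r
  refine ⟨W 0 ∪ W r, Finset.subset_union_right, ?_, ?_⟩
  · exact (Finset.card_union_le _ _).trans (by omega)
  · exact ((h2.monoS (by omega)).monoT hw0).trans h1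

end ReachLemmas
/-! ### The graph -/

/-- Nodes: level, side (`false` is left), exponent, position. -/
abbrev Nd := ℕ × Bool × ℕ × ℕ

/-- Slot predecessors of a node. -/
def pn (G : GFns) (t : ℕ) : Nd → ℕ → Option Nd
  | (l, false, i, x), k =>
    if k < 300 then (if 0 < i then some (l, false, i - 1, G.fL (i - 1) k x) else none)
    else some (l, true, i, G.fM i (k - 300) x)
  | (l, true, i, x), k =>
    if i < t then (if k < 300 then some (l, true, i + 1, G.fR i k x) else none)
    else (if 0 < l then some (l - 1, false, t, x) else none)

/-- Predecessors of a variable. -/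
def pdv (G : GFns) (t : ℕ) (v : Nd × ℕ) : Finset (Nd × ℕ) :=
  ((pn G t v.1 v.2).toFinset.image fun u => (u, 599)) ∪
    (if 0 < v.2 then {(v.1, v.2 - 1)} else ∅)

/-- The rank of a node. -/
def nrk (t : ℕ) : Nd → ℕ
  | (l, false, i, _) => l * (2 * t + 2) + (t + 1 + i)
  | (l, true, i, _) => l * (2 * t + 2) + (t - i)

/-- The rank of a variable. -/
def vrk (t : ℕ) (v : Nd × ℕ) : ℕ := nrk t v.1 * 600 + v.2

/-- The valid variables. -/
def Vld (r t : ℕ) (v : Nd × ℕ) : Prop :=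
  v.1.1 ≤ r ∧ v.1.2.2.1 ≤ t ∧ v.1.2.2.2 < 2 ^ v.1.2.2.1 ∧ v.2 < 600

lemma mem_pdv (G : GFns) (t : ℕ) (v u : Nd × ℕ) : u ∈ pdv G t v ↔
    (u.2 = 599 ∧ pn G t v.1 v.2 = some u.1) ∨ (0 < v.2 ∧ u = (v.1, v.2 - 1)) := by
  unfold pdv
  rw [Finset.mem_union, Finset.mem_image]
  refine or_congr ?_ ?_
  · constructor
    · rintro ⟨a, ha, rfl⟩
      simpa using ha
    · rintro ⟨h1, h2⟩
      exact ⟨u.1, by simpa using h2, by rw [← h1]⟩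
  · split_ifs with h <;> simp [h]

lemma pn_nrk (G : GFns) (t : ℕ) (u v : Nd) (k : ℕ) (h : pn G t v k = some u) :
    nrk t u < nrk t v := by
  obtain ⟨l, b, i, x⟩ := v
  cases b
  · simp only [pn] at h
    split_ifs at h with h1 h2
    · obtain rfl := Option.some.inj h
      simp only [nrk]; omega
    · obtain rfl := Option.some.inj h
      simp only [nrk]; omega
  · simp only [pn] at h
    split_ifs at h with h1 h2 h2
    · obtain rfl := Option.some.inj h
      simp only [nrk]; omega
    · obtain rfl := Option.some.inj h
      simp only [nrk]
      obtain ⟨l, rfl⟩ : ∃ l', l = l' + 1 := ⟨l - 1, by omega⟩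
      have e : (l + 1) * (2 * t + 2) = l * (2 * t + 2) + (2 * t + 2) := by ring
      rw [Nat.add_sub_cancel, e]
      omega

lemma pdv_rk (G : GFns) (t : ℕ) (v u : Nd × ℕ) (h : u ∈ pdv G t v) : vrk t u < vrk t v := by
  rw [mem_pdv] at h
  unfold vrk
  rcases h with ⟨h1, h2⟩ | ⟨h1, rfl⟩
  · have := pn_nrk G t _ _ _ h2
    omega
  · simp only; omega

lemma pdv_card (G : GFns) (t : ℕ) (v : Nd × ℕ) : (pdv G t v).card ≤ 2 := by
  unfold pdv
  refine (Finset.card_union_le _ _).trans ?_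
  have h1 : ((pn G t v.1 v.2).toFinset.image fun u => (u, 599)).card ≤ 1 := by
    refine Finset.card_image_le.trans ?_
    rw [Option.card_toFinset]
    cases pn G t v.1 v.2 <;> simp
  have h2 : (if 0 < v.2 then {(v.1, v.2 - 1)} else ∅ : Finset (Nd × ℕ)).card ≤ 1 := by
    split_ifs <;> simp
  omega

lemma pn_vld (G : GFns) (r t : ℕ) (u v : Nd) (k : ℕ) (h : pn G t v k = some u)
    (hv : v.1 ≤ r ∧ v.2.2.1 ≤ t ∧ v.2.2.2 < 2 ^ v.2.2.1) :
    u.1 ≤ r ∧ u.2.2.1 ≤ t ∧ u.2.2.2 < 2 ^ u.2.2.1 := by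
  obtain ⟨l, b, i, x⟩ := v
  simp only at hv
  cases b
  · simp only [pn] at h
    split_ifs at h with h1 h2
    · obtain rfl := Option.some.inj h
      exact ⟨hv.1, by simp only; omega, G.hL _ _ _⟩
    · obtain rfl := Option.some.inj h
      exact ⟨hv.1, hv.2.1, G.hM _ _ _⟩
  · simp only [pn] at h
    split_ifs at h with h1 h2 h2
    · obtain rfl := Option.some.inj h
      exact ⟨hv.1, by simp only; omega, G.hR _ _ _⟩
    · obtain rfl := Option.some.inj h
      have : i = t := by omega
      subst this
      exact ⟨by simp only; omega, le_rfl, hv.2.2⟩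

lemma pdv_vld (G : GFns) (r t : ℕ) (v u : Nd × ℕ) (h : u ∈ pdv G t v) (hv : Vld r t v) :
    Vld r t u := by
  rw [mem_pdv] at h
  rcases h with ⟨h1, h2⟩ | ⟨h1, rfl⟩
  · obtain ⟨a, b, c⟩ := pn_vld G r t _ _ _ h2 ⟨hv.1, hv.2.1, hv.2.2.1⟩
    exact ⟨a, b, c, by omega⟩
  · obtain ⟨a, b, c, d⟩ := hv
    exact ⟨a, b, c, by simp only; omega⟩

lemma pn_level (G : GFns) (t : ℕ) (u v : Nd) (k : ℕ) (h : pn G t v k = some u) :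
    u.1 = v.1 ∨ u.1 + 1 = v.1 := by
  obtain ⟨l, b, i, x⟩ := v
  cases b
  · simp only [pn] at h
    split_ifs at h with h1 h2
    · obtain rfl := Option.some.inj h
      exact Or.inl rfl
    · obtain rfl := Option.some.inj h
      exact Or.inl rfl
  · simp only [pn] at h
    split_ifs at h with h1 h2 h2
    · obtain rfl := Option.some.inj h
      exact Or.inl rfl
    · obtain rfl := Option.some.inj h
      exact Or.inr (by simp only; omega)

lemma pdv_level (G : GFns) (t : ℕ) (v u : Nd × ℕ) (h : u ∈ pdv G t v) :
    u.1.1 = v.1.1 ∨ u.1.1 + 1 = v.1.1 := by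
  rw [mem_pdv] at h
  rcases h with ⟨h1, h2⟩ | ⟨h1, rfl⟩
  · exact pn_level G t _ _ _ h2
  · exact Or.inl rfl

/-! ### Trajectories on the graph -/

/-- A node is completed at some time of `[a, b]`. -/
def On (A : ℕ → Finset (Nd × ℕ)) (a b : ℕ) (u : Nd) : Prop :=
  ∃ τ, a ≤ τ ∧ τ ≤ b ∧ (u, 599) ∈ A τ

/-- A legal trajectory. -/
def Traj (G : GFns) (t T : ℕ) (A : ℕ → Finset (Nd × ℕ)) : Prop :=
  ∀ τ < T, ∃ v, (A (τ + 1) = insert v (A τ) ∨ A τ = insert v (A (τ + 1))) ∧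
    pdv G t v ⊆ A τ ∧ pdv G t v ⊆ A (τ + 1)

lemma appear {G : GFns} {t T : ℕ} {A : ℕ → Finset (Nd × ℕ)} (hA : Traj G t T A) (a : ℕ)
    (w : Nd × ℕ) (hw : w ∉ A a) (n : ℕ) (hn : a + n ≤ T) (h : w ∈ A (a + n)) :
    ∃ τ, a ≤ τ ∧ τ ≤ a + n ∧ pdv G t w ⊆ A τ := by
  induction n with
  | zero => exact absurd h hw
  | succ n ih =>
    by_cases hh : w ∈ A (a + n)
    · obtain ⟨τ, h1, h2, h3⟩ := ih (by omega) hh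
      exact ⟨τ, h1, by omega, h3⟩
    · obtain ⟨v, h1, h2, h3⟩ := hA (a + n) (by omega)
      rw [← Nat.add_assoc] at h
      rcases h1 with h1 | h1
      · rw [h1, Finset.mem_insert] at h
        rcases h with rfl | h
        · exact ⟨a + n, by omega, by omega, h2⟩
        · exact absurd h hh
      · exact absurd (h1 ▸ Finset.mem_insert_of_mem h) hh

lemma on_pred {G : GFns} {t T : ℕ} {A : ℕ → Finset (Nd × ℕ)} (hA : Traj G t T A) (a b : ℕ)
    (hb : b ≤ T) (u : Nd) (hu : ∀ k, (u, k) ∉ A a) (hon : On A a b u) (k : ℕ) (hk : k < 600)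
    (u' : Nd) (hp : pn G t u k = some u') : On A a b u' := by
  have hall : ∀ n ≤ 599, ∃ τ, a ≤ τ ∧ τ ≤ b ∧ (u, 599 - n) ∈ A τ := by
    intro n
    induction n with
    | zero => intro _; exact hon
    | succ n ih =>
      intro hn
      obtain ⟨τ, h1, h2, h3⟩ := ih (by omega)
      obtain ⟨c, rfl⟩ := Nat.exists_eq_add_of_le h1
      obtain ⟨τ', g1, g2, g3⟩ := appear hA a _ (hu _) c (by omega) h3
      refine ⟨τ', g1, by omega, g3 ?_⟩
      rw [mem_pdv]
      exact Or.inr ⟨by simp only; omega, by simp only [Prod.mk.injEq, true_and]; omega⟩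
  obtain ⟨τ, h1, h2, h3⟩ := hall (599 - k) (by omega)
  rw [show 599 - (599 - k) = k by omega] at h3
  obtain ⟨c, rfl⟩ := Nat.exists_eq_add_of_le h1
  obtain ⟨τ', g1, g2, g3⟩ := appear hA a _ (hu _) c (by omega) h3
  refine ⟨τ', g1, by omega, g3 ?_⟩
  rw [mem_pdv]
  exact Or.inl ⟨rfl, hp⟩

/-- Touched nodes of a level. -/
def tch (A : ℕ → Finset (Nd × ℕ)) (j a : ℕ) : Finset Nd :=
  ((A a).image Prod.fst).filter fun u => u.1 = j

open Classical in
/-- Completed outputs of a level. -/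
noncomputable def muS (t : ℕ) (A : ℕ → Finset (Nd × ℕ)) (j a b : ℕ) : Finset ℕ :=
  (Finset.range (2 ^ t)).filter fun x => On A a b (j, false, t, x)

lemma step_F {G : GFns} {t T : ℕ} {A : ℕ → Finset (Nd × ℕ)} (hA : Traj G t T A) (j a b : ℕ)
    (hb : b ≤ T) (h1 : 11 * (tch A (j + 1) a).card + 1 ≤ (muS t A (j + 1) a b).card)
    (h2 : 2 * (11 * (tch A (j + 1) a).card + 1) ≤ 2 ^ t) :
    2 ^ t ≤ 2 * (muS t A j a b).card := by
  classical
  let SL : ℕ → Finset ℕ := fun i => (Finset.range (2 ^ i)).filter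
    fun x => On A a b (j + 1, false, i, x)
  let SR : ℕ → Finset ℕ := fun i => (Finset.range (2 ^ i)).filter
    fun x => On A a b (j + 1, true, i, x)
  let ZL : ℕ → Finset ℕ := fun i => (Finset.range (2 ^ i)).filter
    fun x => (j + 1, false, i, x) ∈ tch A (j + 1) a
  let ZR : ℕ → Finset ℕ := fun i => (Finset.range (2 ^ i)).filter
    fun x => (j + 1, true, i, x) ∈ tch A (j + 1) a
  have hun : ∀ u : Nd, u.1 = j + 1 → u ∉ tch A (j + 1) a → ∀ k, (u, k) ∉ A a := by
    intro u hu hn k hk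
    exact hn (Finset.mem_filter.2 ⟨Finset.mem_image.2 ⟨_, hk, rfl⟩, hu⟩)
  have hmL : ∀ i x, x ∈ SL i \ ZL i → x < 2 ^ i ∧ On A a b (j + 1, false, i, x) ∧
      ∀ k, ((j + 1, false, i, x), k) ∉ A a := by
    intro i x hx
    simp only [SL, ZL, Finset.mem_sdiff, Finset.mem_filter, Finset.mem_range, not_and] at hx
    exact ⟨hx.1.1, hx.1.2, hun _ rfl (hx.2 hx.1.1)⟩
  have hmR : ∀ i x, x ∈ SR i \ ZR i → x < 2 ^ i ∧ On A a b (j + 1, true, i, x) ∧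
      ∀ k, ((j + 1, true, i, x), k) ∉ A a := by
    intro i x hx
    simp only [SR, ZR, Finset.mem_sdiff, Finset.mem_filter, Finset.mem_range, not_and] at hx
    exact ⟨hx.1.1, hx.1.2, hun _ rfl (hx.2 hx.1.1)⟩
  have hz : ∑ i ∈ Finset.range (t + 1), ((ZL i).card + (ZR i).card) ≤ (tch A (j + 1) a).card := by
    let ZLs : Finset Nd := (Finset.range (t + 1)).biUnion fun i =>
      (ZL i).image (fun x => ((j + 1, false, i, x) : Nd))
    let ZRs : Finset Nd := (Finset.range (t + 1)).biUnion fun i =>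
      (ZR i).image (fun x => ((j + 1, true, i, x) : Nd))
    have cL : ZLs.card = ∑ i ∈ Finset.range (t + 1), (ZL i).card := by
      rw [Finset.card_biUnion]
      · refine Finset.sum_congr rfl fun i _ => Finset.card_image_of_injective _ ?_
        intro x y hxy; simpa using hxy
      · intro i _ i' _ hne
        rw [Function.onFun, Finset.disjoint_left]
        intro u hu hu'
        obtain ⟨x, _, rfl⟩ := Finset.mem_image.1 hu
        obtain ⟨y, _, hy⟩ := Finset.mem_image.1 hu'
        simp at hy
        exact hne hy.1.symm
    have cR : ZRs.card = ∑ i ∈ Finset.range (t + 1), (ZR i).card := by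
      rw [Finset.card_biUnion]
      · refine Finset.sum_congr rfl fun i _ => Finset.card_image_of_injective _ ?_
        intro x y hxy; simpa using hxy
      · intro i _ i' _ hne
        rw [Function.onFun, Finset.disjoint_left]
        intro u hu hu'
        obtain ⟨x, _, rfl⟩ := Finset.mem_image.1 hu
        obtain ⟨y, _, hy⟩ := Finset.mem_image.1 hu'
        simp at hy
        exact hne hy.1.symm
    have hd : Disjoint ZLs ZRs := by
      rw [Finset.disjoint_left]
      intro u hu hu'
      obtain ⟨i, _, hu⟩ := Finset.mem_biUnion.1 hu
      obtain ⟨i', _, hu'⟩ := Finset.mem_biUnion.1 hu'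
      obtain ⟨x, _, rfl⟩ := Finset.mem_image.1 hu
      obtain ⟨y, _, hy⟩ := Finset.mem_image.1 hu'
      simp at hy
    rw [Finset.sum_add_distrib, ← cL, ← cR, ← Finset.card_union_of_disjoint hd]
    refine Finset.card_le_card (Finset.union_subset ?_ ?_)
    · intro u hu
      obtain ⟨i, _, hu⟩ := Finset.mem_biUnion.1 hu
      obtain ⟨x, hx, rfl⟩ := Finset.mem_image.1 hu
      exact (Finset.mem_filter.1 hx).2
    · intro u hu
      obtain ⟨i, _, hu⟩ := Finset.mem_biUnion.1 hu
      obtain ⟨x, hx, rfl⟩ := Finset.mem_image.1 hu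
      exact (Finset.mem_filter.1 hx).2
  have key := gadget G t (tch A (j + 1) a).card SL SR ZL ZR
    (fun i _ => Finset.filter_subset _ _) (fun i _ => Finset.filter_subset _ _)
    (by
      intro i _ x hx d hd
      obtain ⟨g1, g2, g3⟩ := hmL _ _ hx
      refine Finset.mem_filter.2 ⟨Finset.mem_range.2 (G.hL _ _ _), ?_⟩
      refine on_pred hA a b hb _ g3 g2 d (by omega) _ ?_
      simp [pn, hd])
    (by
      intro i _ x hx d hd
      obtain ⟨g1, g2, g3⟩ := hmL _ _ hx
      refine Finset.mem_filter.2 ⟨Finset.mem_range.2 (G.hM _ _ _), ?_⟩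
      refine on_pred hA a b hb _ g3 g2 (d + 300) (by omega) _ ?_
      simp [pn])
    (by
      intro i hi x hx d hd
      obtain ⟨g1, g2, g3⟩ := hmR _ _ hx
      refine Finset.mem_filter.2 ⟨Finset.mem_range.2 (G.hR _ _ _), ?_⟩
      refine on_pred hA a b hb _ g3 g2 d (by omega) _ ?_
      simp [pn, hd, hi])
    hz h1 h2
  have hsub : SR t \ ZR t ⊆ muS t A j a b := by
    intro x hx
    obtain ⟨g1, g2, g3⟩ := hmR _ _ hx
    refine Finset.mem_filter.2 ⟨Finset.mem_range.2 g1, ?_⟩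
    refine on_pred hA a b hb _ g3 g2 0 (by omega) _ ?_
    simp [pn]
  have := Finset.card_le_card hsub
  omega

/-- The pebbling lower bound. -/
lemma traj_lower {G : GFns} {r t T : ℕ} {A : ℕ → Finset (Nd × ℕ)} (hA : Traj G t T A)
    (B y x : ℕ) (hr : 1 ≤ r) (hy : 1 ≤ y) (hB : 1 ≤ B) (hm : 80 * (B * y) ≤ 2 ^ t)
    (hx : x < 2 ^ t)
    (h0 : A 0 = ∅) (hz : ((r, false, t, x), 599) ∈ A T) (hc : ∀ τ ≤ T, (A τ).card < B * y) :
    B ^ (r - 1 - B) ≤ T := by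
  classical
  have hstep : ∀ τ < T, ∃ v, A (τ + 1) ⊆ insert v (A τ) := by
    intro τ hτ
    obtain ⟨v, h1 | h1, _⟩ := hA τ hτ
    · exact ⟨v, h1.le⟩
    · exact ⟨v, (Finset.subset_insert v _).trans (h1.symm.le.trans (Finset.subset_insert v _))⟩
  have hmono : ∀ j a b a' b', (∀ x, On A a b (j, false, t, x) → On A a' b' (j, false, t, x)) →
      (muS t A j a b).card ≤ (muS t A j a' b').card := by
    intro j a b a' b' h
    refine Finset.card_le_card fun x hx => ?_
    rw [muS, Finset.mem_filter] at hx ⊢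
    exact ⟨hx.1, h x hx.2⟩
  have h1B : 1 ≤ B * y := Nat.mul_pos hB hy
  have main := abstract_lower T (2 ^ t) B y r (fun j a b => (muS t A j a b).card)
    (fun j a => (tch A j a).card) hy hB hm ?_ ?_ ?_ ?_ ?_ ?_ (r - 1) B 0 T (by omega) le_rfl
    (Nat.zero_le _) le_rfl ?_ ?_
  · simpa using main
  · intro j a b c hab hbc
    refine (Finset.card_le_card (t := muS t A j a b ∪ muS t A j b c) ?_).trans
      (Finset.card_union_le _ _)
    intro x hx
    rw [Finset.mem_union]
    simp only [muS, Finset.mem_filter] at hx ⊢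
    obtain ⟨hx, τ, g1, g2, g3⟩ := hx
    rcases Nat.le_total τ b with h | h
    · exact Or.inl ⟨hx, τ, g1, h, g3⟩
    · exact Or.inr ⟨hx, τ, h, g2, g3⟩
  · intro j a b hab hb
    obtain ⟨v, hv⟩ := hstep b hb
    refine (Finset.card_le_card (t := insert v.1.2.2.2 (muS t A j a b)) ?_).trans
      (Finset.card_insert_le _ _)
    intro x hx
    rw [Finset.mem_insert]
    simp only [muS, Finset.mem_filter] at hx ⊢
    obtain ⟨hx, τ, g1, g2, g3⟩ := hx
    rcases Nat.lt_or_ge b τ with h | h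
    · have : τ = b + 1 := by omega
      subst this
      rcases Finset.mem_insert.1 (hv g3) with h' | h'
      · left; rw [← h']
      · exact Or.inr ⟨hx, b, hab, le_rfl, h'⟩
    · exact Or.inr ⟨hx, τ, g1, h, g3⟩
  · intro j a
    refine Finset.card_le_card_of_injOn (fun x => ((j, false, t, x) : Nd)) ?_ ?_
    · intro x hx
      rw [Finset.mem_coe, muS, Finset.mem_filter] at hx
      obtain ⟨hx, τ, g1, g2, g3⟩ := hx
      have : τ = a := by omega
      subst this
      exact Finset.mem_filter.2 ⟨Finset.mem_image.2 ⟨_, g3, rfl⟩, rfl⟩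
    · intro x _ y _ hxy
      simpa using hxy
  · intro j a a' b b' h1 h2
    exact hmono _ _ _ _ _ fun x ⟨τ, g1, g2, g3⟩ => ⟨τ, by omega, by omega, g3⟩
  · intro j τ hτ
    obtain ⟨v, hv⟩ := hstep τ hτ
    refine (Finset.card_le_card (t := insert v.1 (tch A j τ)) ?_).trans
      (Finset.card_insert_le _ _)
    intro u hu
    obtain ⟨h1, h2⟩ := Finset.mem_filter.1 hu
    obtain ⟨w, hw, rfl⟩ := Finset.mem_image.1 h1
    rcases Finset.mem_insert.1 (hv hw) with h' | h'
    · rw [h']; exact Finset.mem_insert_self _ _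
    · exact Finset.mem_insert_of_mem (Finset.mem_filter.2 ⟨Finset.mem_image.2 ⟨_, h', rfl⟩, h2⟩)
  · intro j a b _ _ hb h1 h2
    exact step_F hA j a b hb h1 h2
  · have hs0 : tch A (r - 1 + 1) 0 = ∅ := by simp [tch, h0]
    refine step_F hA (r - 1) 0 T le_rfl ?_ ?_
    · rw [hs0]
      simp only [Finset.card_empty, Nat.mul_zero, Nat.zero_add]
      rw [Nat.succ_le_iff, Finset.card_pos]
      refine ⟨x, Finset.mem_filter.2 ⟨Finset.mem_range.2 hx, T, Nat.zero_le _, le_rfl, ?_⟩⟩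
      rwa [Nat.sub_add_cancel hr]
    · rw [hs0]
      simp only [Finset.card_empty, Nat.mul_zero, Nat.zero_add]
      omega
  · intro τ _ hτ
    refine lt_of_le_of_lt ?_ (hc τ hτ)
    refine le_trans ?_ (Finset.card_image_le (s := A τ) (f := Prod.fst))
    rw [← Finset.card_biUnion]
    · refine Finset.card_le_card fun u hu => ?_
      obtain ⟨i, _, hu⟩ := Finset.mem_biUnion.1 hu
      exact (Finset.mem_filter.1 hu).1
    · intro i _ i' _ hne
      rw [Function.onFun, Finset.disjoint_left]
      intro u hu hu'
      exact hne ((Finset.mem_filter.1 hu).2.symm.trans (Finset.mem_filter.1 hu').2)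
/-! ### The formula -/

/-- Column positions. -/
def colset (t : ℕ) : Finset (ℕ × ℕ) :=
  (Finset.range (t + 1)).biUnion fun i => (Finset.range (2 ^ i)).image (Prod.mk i)

lemma mem_colset (t : ℕ) (p : ℕ × ℕ) : p ∈ colset t ↔ p.1 ≤ t ∧ p.2 < 2 ^ p.1 := by
  obtain ⟨i, x⟩ := p
  simp only [colset, Finset.mem_biUnion, Finset.mem_range, Finset.mem_image, Prod.mk.injEq]
  constructor
  · rintro ⟨i', h1, x', h2, rfl, rfl⟩
    exact ⟨by omega, h2⟩
  · rintro ⟨h1, h2⟩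
    exact ⟨i, by omega, x, h2, rfl, rfl⟩

lemma colset_le (t : ℕ) : (colset t).card ≤ 2 * 2 ^ t := by
  refine Finset.card_biUnion_le.trans ?_
  have h : ∀ i, ((Finset.range (2 ^ i)).image (Prod.mk i)).card ≤ 2 ^ i := fun i =>
    Finset.card_image_le.trans (by simp)
  refine (Finset.sum_le_sum fun i _ => h i).trans ?_
  have : ∀ n, ∑ i ∈ Finset.range n, 2 ^ i ≤ 2 ^ n := by
    intro n
    induction n with
    | zero => simp
    | succ n ih => rw [Finset.sum_range_succ, pow_succ]; omega
  refine (this (t + 1)).trans ?_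
  rw [pow_succ']

lemma le_colset (t : ℕ) : 2 ^ t ≤ (colset t).card := by
  have : ((Finset.range (2 ^ t)).image (Prod.mk t)).card = 2 ^ t := by
    rw [Finset.card_image_of_injective _ (fun x y h => by simpa using h)]; simp
  rw [← this]
  refine Finset.card_le_card fun p hp => ?_
  obtain ⟨x, hx, rfl⟩ := Finset.mem_image.1 hp
  rw [mem_colset]
  exact ⟨le_rfl, Finset.mem_range.1 hx⟩

/-- The set of valid variables. -/
def VS (r t : ℕ) : Finset (Nd × ℕ) :=
  (Finset.range (r + 1) ×ˢ (Finset.univ : Finset Bool) ×ˢ colset t) ×ˢ Finset.range 600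

lemma mem_VS (r t : ℕ) (v : Nd × ℕ) : v ∈ VS r t ↔ Vld r t v := by
  simp only [VS, Finset.mem_product, Finset.mem_univ, true_and, Finset.mem_range, mem_colset, Vld]
  constructor
  · rintro ⟨⟨a, b, c⟩, d⟩; exact ⟨by omega, b, c, d⟩
  · rintro ⟨a, b, c, d⟩; exact ⟨⟨by omega, b, c⟩, d⟩

lemma VS_card (r t : ℕ) : (VS r t).card = (r + 1) * (2 * (colset t).card) * 600 := by
  simp [VS, Finset.card_product]

/-- The variable with a given index. -/
noncomputable def vv (r t : ℕ) (i : Fin (VS r t).card) : Nd × ℕ := ((VS r t).equivFin.symm i).1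

lemma vv_inj (r t : ℕ) : Function.Injective (vv r t) := by
  intro i j h
  exact (VS r t).equivFin.symm.injective (Subtype.ext h)

lemma vv_vld (r t : ℕ) (i : Fin (VS r t).card) : Vld r t (vv r t i) :=
  (mem_VS r t _).1 ((VS r t).equivFin.symm i).2

lemma vv_surj (r t : ℕ) (v : Nd × ℕ) (hv : Vld r t v) : ∃ i, vv r t i = v :=
  ⟨(VS r t).equivFin ⟨v, (mem_VS r t v).2 hv⟩, by simp [vv]⟩

/-- Predecessors of indices. -/
noncomputable def pdN (G : GFns) (r t : ℕ) (i : Fin (VS r t).card) : Finset (Fin (VS r t).card) :=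
  Finset.univ.filter fun j => vv r t j ∈ pdv G t (vv r t i)

lemma sink_vld (r t : ℕ) : Vld r t (((r, false, t, 0), 599) : Nd × ℕ) :=
  ⟨le_rfl, le_rfl, by simp, by simp⟩

/-- The sink. -/
noncomputable def snk (r t : ℕ) : Fin (VS r t).card :=
  (vv_surj r t _ (sink_vld r t)).choose

lemma vv_snk (r t : ℕ) : vv r t (snk r t) = ((r, false, t, 0), 599) :=
  (vv_surj r t _ (sink_vld r t)).choose_spec

lemma pdN_map (G : GFns) (r t : ℕ) (i : Fin (VS r t).card) :
    (pdN G r t i).image (vv r t) = pdv G t (vv r t i) := by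
  ext u
  rw [Finset.mem_image]
  constructor
  · rintro ⟨j, hj, rfl⟩
    exact (Finset.mem_filter.1 hj).2
  · intro hu
    obtain ⟨j, rfl⟩ := vv_surj r t u (pdv_vld G r t _ u hu (vv_vld r t i))
    exact ⟨j, Finset.mem_filter.2 ⟨Finset.mem_univ _, hu⟩, rfl⟩

lemma pdN_card (G : GFns) (r t : ℕ) (i : Fin (VS r t).card) : (pdN G r t i).card ≤ 2 := by
  rw [← Finset.card_image_of_injective _ (vv_inj r t), pdN_map]
  exact pdv_card G t _

lemma pdN_rk (G : GFns) (r t : ℕ) (i j : Fin (VS r t).card) (h : j ∈ pdN G r t i) :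
    vrk t (vv r t j) < vrk t (vv r t i) :=
  pdv_rk G t _ _ (Finset.mem_filter.1 h).2

/-- The formula. -/
noncomputable def Phi (G : GFns) (r t : ℕ) : CNF := pebCNF (VS r t).card (pdN G r t) (snk r t)

lemma Phi_is3 (G : GFns) (r t : ℕ) : (Phi G r t).Is3CNF := pebCNF_is3 _ _ _ (pdN_card G r t)

lemma Phi_unsat (G : GFns) (r t : ℕ) : (Phi G r t).Unsat :=
  pebCNF_unsat _ _ _ (fun i => vrk t (vv r t i)) (pdN_rk G r t)

lemma Phi_nvars (G : GFns) (r t : ℕ) :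
    1200 * ((r + 1) * 2 ^ t) ≤ (Phi G r t).nvars ∧
      (Phi G r t).nvars ≤ 2400 * ((r + 1) * 2 ^ t) := by
  have h1 := Nat.mul_le_mul_left (r + 1) (le_colset t)
  have h2 := Nat.mul_le_mul_left (r + 1) (colset_le t)
  have e : (Phi G r t).nvars = 1200 * ((r + 1) * (colset t).card) :=
    (VS_card r t).trans (by ring)
  rw [e]
  constructor
  · omega
  · rw [show (r + 1) * (2 * 2 ^ t) = 2 * ((r + 1) * 2 ^ t) by ring] at h2
    omega

lemma Phi_clauses (G : GFns) (r t : ℕ) : (Phi G r t).clauses.card = (Phi G r t).nvars + 1 :=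
  pebCNF_card _ _ _

lemma Phi_depth (G : GFns) (r t : ℕ) (F : Type) [Field F] :
    ∃ q s, IsNSCert ((Phi G r t).polys F) q s ∧
      nsDegree ((Phi G r t).polys F) q s ≤ 1800 * ((r + 1) * (2 * t + 2)) + 3 := by
  obtain ⟨T, hT⟩ := reach_depth (fun i => vrk t (vv r t i)) (pdN_rk G r t) (pdN_card G r t)
    (600 * ((r + 1) * (2 * t + 2))) (snk r t) (by
      simp only [vv_snk, vrk, nrk]
      have : (r + 1) * (2 * t + 2) = r * (2 * t + 2) + (2 * t + 2) := by ring
      omega)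
  obtain ⟨q, s, h1, h2, h3⟩ := reach_cert F (pdN G r t) (snk r t) hT (by simp) (by
    rw [Finset.card_singleton]; omega)
  exact ⟨q, s, h1, h2.trans (by omega)⟩

lemma Phi_layers (G : GFns) (r t l k : ℕ) (hr : r ≤ (l + 1) ^ k) (F : Type) [Field F] :
    ∃ q s, IsNSCert ((Phi G r t).polys F) q s ∧
      nsDegree ((Phi G r t).polys F) q s ≤ (k * (l + 1) + 2) * (2400 * 2 ^ t) ∧
      nsSize ((Phi G r t).polys F) q s ≤
        2 * (2400 * 2 ^ t + (2 * (l + 1)) ^ k * (2400 * 2 ^ t)) + 1 := by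
  let W : ℕ → Finset (Fin (VS r t).card) := fun j => Finset.univ.filter fun i => (vv r t i).1.1 = j
  have hw : ∀ j, (W j).card ≤ 2400 * 2 ^ t := by
    intro j
    rw [← Finset.card_image_of_injective _ (vv_inj r t)]
    refine (Finset.card_le_card (t := (({j} : Finset ℕ) ×ˢ (Finset.univ : Finset Bool) ×ˢ
      colset t) ×ˢ Finset.range 600) ?_).trans ?_
    · intro u hu
      obtain ⟨i, hi, rfl⟩ := Finset.mem_image.1 hu
      have hi' := (Finset.mem_filter.1 hi).2
      obtain ⟨a, b, c, d⟩ := vv_vld r t i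
      simp only [Finset.mem_product, Finset.mem_singleton, Finset.mem_univ, true_and, mem_colset,
        Finset.mem_range]
      exact ⟨⟨hi', b, c⟩, d⟩
    · have := colset_le t
      simp only [Finset.card_product, Finset.card_singleton, Finset.card_univ, Fintype.card_bool,
        Finset.card_range]
      omega
  obtain ⟨B, hB, hBc, hR⟩ := reach_layers (fun i => vrk t (vv r t i)) (pdN_rk G r t)
    (2400 * 2 ^ t) l k r W hw (by
      intro i hi j hj
      have h1 := (Finset.mem_filter.1 hi).2
      have h2 := pdv_level G t _ _ (Finset.mem_filter.1 hj).2
      exact Finset.mem_filter.2 ⟨Finset.mem_univ _, by omega⟩) (by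
      intro i' _ i hi j hj
      have h1 := (Finset.mem_filter.1 hi).2
      have h2 := pdv_level G t _ _ (Finset.mem_filter.1 hj).2
      rw [Finset.mem_union]
      rcases h2 with h2 | h2
      · exact Or.inr (Finset.mem_filter.2 ⟨Finset.mem_univ _, by omega⟩)
      · exact Or.inl (Finset.mem_filter.2 ⟨Finset.mem_univ _, by omega⟩)) hr
  obtain ⟨q, s, h1, h2, h3⟩ := reach_cert F (pdN G r t) (snk r t) hR (hB
    (Finset.mem_filter.2 ⟨Finset.mem_univ _, by rw [vv_snk]⟩)) hBc
  exact ⟨q, s, h1, h2, h3⟩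

lemma Phi_lower (G : GFns) (r t B y : ℕ) (hr : 1 ≤ r) (hy : 1 ≤ y) (hB : 1 ≤ B)
    (hm : 80 * (B * y) ≤ 2 ^ t) (F : Type) [Field F]
    (q : {C // C ∈ (Phi G r t).clauses} → MvPolynomial (Fin (Phi G r t).nvars) F)
    (s : Fin (Phi G r t).nvars → MvPolynomial (Fin (Phi G r t).nvars) F)
    (h : IsNSCert ((Phi G r t).polys F) q s)
    (hd : nsDegree ((Phi G r t).polys F) q s < B * y) :
    B ^ (r - 1 - B) ≤ nsSize ((Phi G r t).polys F) q s := by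
  obtain ⟨T, A, hT, h0, hz, hA, hstep⟩ := ns_trajectory F (pdN G r t) (snk r t) q s h
  refine le_trans ?_ hT
  refine traj_lower (G := G) (r := r) (t := t) (A := fun τ => (A τ).image (vv r t)) ?_ B y 0 hr hy
    hB hm (by positivity) (by simp [h0]) ?_ ?_
  · intro τ hτ
    obtain ⟨v, h1, h2, h3⟩ := hstep τ hτ
    refine ⟨vv r t v, ?_, ?_, ?_⟩
    · simp only [← Finset.image_insert]
      exact h1.imp (fun h => by rw [h]) (fun h => congrArg (Finset.image (vv r t)) h)
    · rw [← pdN_map]; exact Finset.image_subset_image h2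
    · rw [← pdN_map]; exact Finset.image_subset_image h3
  · exact Finset.mem_image.2 ⟨_, hz, vv_snk r t⟩
  · intro τ hτ
    exact lt_of_le_of_lt (Finset.card_image_le.trans (hA τ hτ)) hd
/-! ### Parameters -/

/-- Number of levels. -/
def prR (n : ℕ) : ℕ := Nat.log 2 n + 1

/-- Exponent of the width. -/
def prT (n : ℕ) : ℕ := Nat.log 2 (n / prR n)

lemma pr_bounds (n : ℕ) (hn : 1 ≤ n) :
    prR n * 2 ^ prT n ≤ n ∧ n ≤ 2 * (prR n * 2 ^ prT n) ∧ prT n + 1 ≤ prR n := by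
  have hr : prR n ≤ n := Nat.log_lt_self 2 (by omega)
  have hr0 : 0 < prR n := Nat.succ_pos _
  have hq : 0 < n / prR n := Nat.div_pos hr hr0
  have h1 : 2 ^ prT n ≤ n / prR n := Nat.pow_log_le_self 2 hq.ne'
  have h2 : n / prR n < 2 ^ (prT n + 1) := Nat.lt_pow_succ_log_self (by norm_num) _
  have h3 : prR n * (n / prR n) ≤ n := Nat.mul_div_le _ _
  have h4 : n < prR n * (n / prR n + 1) := Nat.lt_mul_div_succ n hr0
  refine ⟨(Nat.mul_le_mul_left _ h1).trans h3, ?_, ?_⟩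
  · have h5 : prR n * (n / prR n + 1) ≤ prR n * 2 ^ (prT n + 1) := Nat.mul_le_mul_left _ h2
    rw [pow_succ] at h5
    have : prR n * (2 ^ prT n * 2) = 2 * (prR n * 2 ^ prT n) := by ring
    omega
  · have : prT n ≤ Nat.log 2 n := Nat.log_mono_right (Nat.div_le_self _ _)
    unfold prR
    omega

lemma pr_log (n : ℕ) (hn : 2 ≤ n) :
    1 ≤ Real.logb 2 n ∧ (prR n : ℝ) ≤ Real.logb 2 n + 1 ∧ Real.logb 2 n ≤ prR n := by
  have hn0 : (0 : ℝ) < n := by positivity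
  refine ⟨?_, ?_, ?_⟩
  · rw [Real.le_logb_iff_rpow_le (by norm_num) hn0]
    rw [Real.rpow_one]; exact_mod_cast hn
  · unfold prR
    push_cast
    have : (Nat.log 2 n : ℝ) ≤ Real.logb 2 n := by
      rw [Real.le_logb_iff_rpow_le (by norm_num) hn0, Real.rpow_natCast]
      exact_mod_cast Nat.pow_log_le_self 2 (by omega)
    linarith
  · rw [Real.logb_le_iff_le_rpow (by norm_num) hn0, Real.rpow_natCast]
    exact_mod_cast (Nat.lt_pow_succ_log_self (by norm_num) n).le

lemma part2_num (δ : ℝ) (hδ : 0 < δ) : ∃ k : ℕ, ∃ C : ℝ, 0 < C ∧ ∀ n : ℕ, 2 ≤ n →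
    ∃ l : ℕ, prR n ≤ (l + 1) ^ k ∧
      (((2 * (2400 * 2 ^ prT n + (2 * (l + 1)) ^ k * (2400 * 2 ^ prT n)) + 1 : ℕ) : ℝ) ≤ C * n) ∧
      (((k * (l + 1) + 2) * (2400 * 2 ^ prT n) : ℕ) : ℝ) ≤
        C * n / (Real.logb 2 n) ^ ((1 : ℝ) - δ) := by
  set k := ⌈1 / δ⌉₊ with hk
  have hk1 : 1 ≤ k := Nat.one_le_iff_ne_zero.2 (Nat.ceil_pos.2 (by positivity)).ne'
  have hk0 : (0 : ℝ) < k := by exact_mod_cast hk1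
  have hkδ : (1 : ℝ) / k ≤ δ := by
    have : 1 / δ ≤ k := Nat.le_ceil _
    rw [div_le_iff₀ hδ] at this
    rw [div_le_iff₀ hk0]; linarith
  have h4 : (1 : ℝ) ≤ 4 ^ k := one_le_pow₀ (by norm_num)
  refine ⟨k, 4801 + 4800 * 4 ^ k + 2400 * (2 * k + 2), by positivity, fun n hn => ?_⟩
  obtain ⟨b1, b2, b3⟩ := pr_bounds n (by omega)
  obtain ⟨l1, l2, l3⟩ := pr_log n hn
  set L := Real.logb 2 n with hL
  set r := prR n with hr
  set m := 2 ^ prT n with hm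
  have hr1 : (1 : ℝ) ≤ r := l1.trans l3
  set ρ : ℝ := (r : ℝ) ^ ((1 : ℝ) / k) with hρ
  have hρ1 : 1 ≤ ρ := Real.one_le_rpow hr1 (by positivity)
  have hρk : ρ ^ k = r := by
    rw [hρ, ← Real.rpow_natCast, ← Real.rpow_mul (by linarith), one_div, inv_mul_cancel₀ hk0.ne',
      Real.rpow_one]
  have hc1 : 1 ≤ ⌈ρ⌉₊ := Nat.one_le_iff_ne_zero.2 (Nat.ceil_pos.2 (by linarith)).ne'
  have hl : ((⌈ρ⌉₊ - 1 + 1 : ℕ)) = ⌈ρ⌉₊ := Nat.sub_add_cancel hc1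
  have hcl : (⌈ρ⌉₊ : ℝ) ≤ 2 * ρ := by
    have := Nat.ceil_lt_add_one (by linarith : 0 ≤ ρ)
    linarith
  have hrm : (r : ℝ) * m ≤ n := by exact_mod_cast b1
  have hm0 : (0 : ℝ) ≤ m := by positivity
  have hmn : (m : ℝ) ≤ n := le_trans (by nlinarith) hrm
  have hn1 : (1 : ℝ) ≤ n := by exact_mod_cast (by omega : 1 ≤ n)
  refine ⟨⌈ρ⌉₊ - 1, ?_, ?_, ?_⟩
  · rw [hl]
    have : (r : ℝ) ≤ (⌈ρ⌉₊ : ℝ) ^ k := by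
      rw [← hρk]; exact pow_le_pow_left₀ (by linarith) (Nat.le_ceil _) _
    exact_mod_cast this
  · rw [hl]
    push_cast
    have h5 : (2 * (⌈ρ⌉₊ : ℝ)) ^ k ≤ 4 ^ k * r := by
      rw [← hρk, ← mul_pow]
      exact pow_le_pow_left₀ (by positivity) (by linarith) _
    have h6 : (2 * (⌈ρ⌉₊ : ℝ)) ^ k * (2400 * m) ≤ 4 ^ k * 2400 * n := by
      calc (2 * (⌈ρ⌉₊ : ℝ)) ^ k * (2400 * m) ≤ 4 ^ k * (r : ℝ) * (2400 * (m : ℝ)) := mul_le_mul_of_nonneg_right h5 (by positivity)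
        _ = 4 ^ k * 2400 * ((r : ℝ) * m) := by ring
        _ ≤ _ := mul_le_mul_of_nonneg_left hrm (by positivity)
    have h7 : (0 : ℝ) ≤ 2400 * (2 * k + 2) * n := by positivity
    nlinarith
  · rw [hl]
    push_cast
    have hLp : 0 < L := by linarith
    have h5 : ((k : ℝ) * ⌈ρ⌉₊ + 2) ≤ (2 * k + 2) * ρ := by
      have := mul_le_mul_of_nonneg_left hcl hk0.le
      linarith
    have h6 : (m : ℝ) ≤ n / r := by
      rw [le_div_iff₀ (by linarith)]; linarith
    have h7 : ρ / r ≤ 1 / L ^ ((1 : ℝ) - δ) := by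
      have e1 : ρ / r = (r : ℝ) ^ ((1 : ℝ) / k - 1) := by
        rw [Real.rpow_sub (by linarith), Real.rpow_one]
      have e2 : 1 / L ^ ((1 : ℝ) - δ) = L ^ (δ - 1) := by
        rw [one_div, ← Real.rpow_neg hLp.le]; congr 1; ring
      rw [e1, e2]
      have hk1' : (1 : ℝ) / k ≤ 1 := by
        rw [div_le_one hk0]; exact_mod_cast hk1
      calc (r : ℝ) ^ ((1 : ℝ) / k - 1) ≤ L ^ ((1 : ℝ) / k - 1) :=
            Real.rpow_le_rpow_of_nonpos hLp l3 (by linarith)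
        _ ≤ _ := Real.rpow_le_rpow_of_exponent_le l1 (by linarith)
    calc ((k : ℝ) * ⌈ρ⌉₊ + 2) * (2400 * m) ≤ ((2 * k + 2) * ρ) * (2400 * (n / r)) := by
          gcongr
      _ = (2400 * (2 * k + 2)) * n * (ρ / r) := by ring
      _ ≤ (2400 * (2 * k + 2)) * n * (1 / L ^ ((1 : ℝ) - δ)) := by gcongr
      _ = (2400 * (2 * k + 2)) * n / L ^ ((1 : ℝ) - δ) := by ring
      _ ≤ _ := by
        have : (0 : ℝ) < L ^ ((1 : ℝ) - δ) := Real.rpow_pos_of_pos hLp _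
        gcongr
        linarith

lemma pow_big (r : ℕ) (hr : 64 ≤ r) : 320 * r ^ 2 ≤ 2 ^ (r - 1) := by
  obtain ⟨k, rfl⟩ := Nat.exists_eq_add_of_le hr
  induction k with
  | zero => norm_num
  | succ k ih =>
    have ih := ih (by omega)
    have e : 64 + (k + 1) - 1 = (64 + k - 1) + 1 := by omega
    have e2 : 2 ^ (64 + k - 1 + 1) = 2 ^ (64 + k - 1) * 2 := pow_succ _ _
    rw [e, e2]
    generalize 2 ^ (64 + k - 1) = p at ih ⊢
    nlinarith

lemma part3_num (n : ℕ) (hn : 2 ^ 64 ≤ n) : ∃ B y : ℕ, 1 ≤ B ∧ 1 ≤ y ∧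
    80 * (B * y) ≤ 2 ^ prT n ∧
    (1 / 1000 : ℝ) * n / Real.logb 2 n < ((B * y : ℕ) : ℝ) ∧
    (n : ℝ) ^ ((1 / 8 : ℝ) * Real.logb 2 (Real.logb 2 n)) ≤ ((B ^ (prR n - 1 - B) : ℕ) : ℝ) := by
  have hn2 : 2 ≤ n := le_trans (by norm_num) hn
  obtain ⟨b1, b2, b3⟩ := pr_bounds n (by omega)
  obtain ⟨l1, l2, l3⟩ := pr_log n hn2
  have hr64 : 64 ≤ prR n := by
    have : 64 ≤ Nat.log 2 n := Nat.le_log_of_pow_le (by norm_num) hn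
    unfold prR; omega
  have hbig : 320 * prR n ^ 2 ≤ n :=
    (pow_big _ hr64).trans (Nat.pow_log_le_self 2 (by omega))
  set L := Real.logb 2 n with hL
  set r := prR n with hr
  set m := 2 ^ prT n with hm
  set β := Nat.log 4 r with hβ
  have hβ1 : 1 ≤ β := Nat.le_log_of_pow_le (by norm_num) (by omega)
  have hB2 : 2 ^ β * 2 ^ β ≤ r := by
    have : 4 ^ β ≤ r := Nat.pow_log_le_self 4 (by omega)
    rwa [show 4 = 2 * 2 by norm_num, mul_pow] at this
  have hrβ : r < 4 ^ (β + 1) := Nat.lt_pow_succ_log_self (by norm_num) _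
  set B := 2 ^ β with hB
  have hBpos : 1 ≤ B := Nat.one_le_two_pow
  have hB8 : 8 * B ≤ r := by
    rcases Nat.lt_or_ge B 8 with h | h
    · omega
    · exact (Nat.mul_le_mul_right B h).trans hB2
  have hmB : 160 * B ≤ m := by
    by_contra hcon
    push Not at hcon
    have : n < 320 * r ^ 2 := by
      have h1 : r * m < r * (160 * r) := by
        refine Nat.mul_lt_mul_of_pos_left ?_ (by omega)
        omega
      have : 320 * r ^ 2 = 2 * (r * (160 * r)) := by ring
      omega
    omega
  have hy : 80 * B * (m / (80 * B)) ≤ m := Nat.mul_div_le _ _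
  have hy2 : m < 80 * B * (m / (80 * B) + 1) := Nat.lt_mul_div_succ m (by omega)
  set y := m / (80 * B) with hydef
  have hByle : 80 * (B * y) ≤ m := by rw [← Nat.mul_assoc]; exact hy
  have hBy : m ≤ 160 * (B * y) := by
    have : 80 * B * (y + 1) = 80 * (B * y) + 80 * B := by ring
    omega
  refine ⟨B, y, hBpos, ?_, hByle, ?_, ?_⟩
  · exact Nat.div_pos (by omega) (by omega)
  · have hLp : 0 < L := by linarith
    rw [div_lt_iff₀ hLp]
    have h1 : (m : ℝ) ≤ 160 * ((B * y : ℕ) : ℝ) := by exact_mod_cast hBy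
    have h2 : (n : ℝ) ≤ 2 * (r * m) := by exact_mod_cast b2
    have h3 : (r : ℝ) ≤ 2 * L := by linarith
    have hn0 : (0 : ℝ) < n := by exact_mod_cast (by omega : 0 < n)
    have hm0 : (0 : ℝ) ≤ m := by positivity
    have h4 : (r : ℝ) * m ≤ 2 * L * (160 * ((B * y : ℕ) : ℝ)) :=
      mul_le_mul h3 h1 hm0 (by positivity)
    nlinarith
  · have hn0 : (0 : ℝ) < n := by exact_mod_cast (by omega : 0 < n)
    have e1 : (n : ℝ) = (2 : ℝ) ^ L := (Real.rpow_logb (by norm_num) (by norm_num) hn0).symm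
    rw [e1, ← Real.rpow_mul (by norm_num)]
    have e2 : ((B ^ (r - 1 - B) : ℕ) : ℝ) = (2 : ℝ) ^ ((β * (r - 1 - B) : ℕ) : ℝ) := by
      rw [Real.rpow_natCast, hB, ← pow_mul]
      push_cast; rfl
    rw [e2]
    refine Real.rpow_le_rpow_of_exponent_le (by norm_num) ?_
    have hlr : Real.logb 2 L ≤ 4 * β := by
      have hr0 : (0 : ℝ) < r := by linarith
      calc Real.logb 2 L ≤ Real.logb 2 r := Real.logb_le_logb_of_le (by norm_num) (by linarith) l3
        _ ≤ (2 * (β + 1) : ℕ) := by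
          rw [Real.logb_le_iff_le_rpow (by norm_num) hr0, Real.rpow_natCast, pow_mul]
          have : (r : ℝ) ≤ 4 ^ (β + 1) := by exact_mod_cast hrβ.le
          norm_num
          exact this
        _ ≤ _ := by
          push_cast
          have : (1 : ℝ) ≤ β := by exact_mod_cast hβ1
          linarith
    have hlog0 : 0 ≤ Real.logb 2 L := Real.logb_nonneg (by norm_num) l1
    have h5 : (r : ℝ) ≤ 2 * ((r - 1 - B : ℕ) : ℝ) := by
      exact_mod_cast (by omega : r ≤ 2 * (r - 1 - B))
    have h6 : L * Real.logb 2 L ≤ (2 * ((r - 1 - B : ℕ) : ℝ)) * (4 * β) :=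
      mul_le_mul (l3.trans h5) hlr hlog0 (by positivity)
    rw [Nat.cast_mul]
    linarith
/-- There is a family of unsatisfiable 3-CNF formulas of size `Θ(n)` such that,
over any field: (1) there is a Nullstellensatz refutation of degree `O(log² n)`;
(2) for every `δ > 0` there is a refutation of size `O(n)` and degree `O(n / log^{1-δ} n)`;
(3) there is a `K > 0` such that every refutation of degree at most `K n / log n` has size
`n^{Ω(log log n)}`. -/
theorem nullstellensatz_robust_tradeoff :
    ∃ φ : ℕ → CNF,
      (∀ n, (φ n).Is3CNF ∧ (φ n).Unsat) ∧
      (∃ a b : ℝ, 0 < a ∧ 0 < b ∧ ∀ n : ℕ, 1 ≤ n →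
        a * n ≤ ((φ n).nvars : ℝ) ∧ ((φ n).nvars : ℝ) ≤ b * n ∧
        a * n ≤ ((φ n).clauses.card : ℝ) ∧ ((φ n).clauses.card : ℝ) ≤ b * n) ∧
      ∀ (F : Type) [Field F],
        -- (1) a refutation of degree O(log² n)
        (∃ C : ℝ, 0 < C ∧ ∃ N : ℕ, ∀ n : ℕ, N ≤ n →
          ∃ r s, IsNSCert ((φ n).polys F) r s ∧
            (nsDegree ((φ n).polys F) r s : ℝ) ≤ C * (Real.logb 2 n) ^ 2) ∧
        -- (2) a refutation of size O(n) and degree O(n / log^{1-δ} n)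
        (∀ δ : ℝ, 0 < δ → ∃ C : ℝ, 0 < C ∧ ∃ N : ℕ, ∀ n : ℕ, N ≤ n →
          ∃ r s, IsNSCert ((φ n).polys F) r s ∧
            (nsSize ((φ n).polys F) r s : ℝ) ≤ C * (n : ℝ) ∧
            (nsDegree ((φ n).polys F) r s : ℝ) ≤
              C * (n : ℝ) / (Real.logb 2 n) ^ ((1 : ℝ) - δ)) ∧
        -- (3) size n^{Ω(log log n)} for degree at most K n / log n
        (∃ K : ℝ, 0 < K ∧ ∃ c : ℝ, 0 < c ∧ ∃ N : ℕ, ∀ n : ℕ, N ≤ n →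
          ∀ r s, IsNSCert ((φ n).polys F) r s →
            (nsDegree ((φ n).polys F) r s : ℝ) ≤ K * (n : ℝ) / Real.logb 2 n →
            (n : ℝ) ^ (c * Real.logb 2 (Real.logb 2 n)) ≤
              (nsSize ((φ n).polys F) r s : ℝ)) := by
  obtain ⟨G⟩ := exists_gfns
  refine ⟨fun n => Phi G (prR n) (prT n), fun n => ⟨Phi_is3 _ _ _, Phi_unsat _ _ _⟩, ?_, ?_⟩
  · refine ⟨1, 4801, by norm_num, by norm_num, fun n hn => ?_⟩
    obtain ⟨b1, b2, b3⟩ := pr_bounds n hn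
    obtain ⟨v1, v2⟩ := Phi_nvars G (prR n) (prT n)
    have hc := Phi_clauses G (prR n) (prT n)
    have e : (prR n + 1) * 2 ^ prT n = prR n * 2 ^ prT n + 2 ^ prT n := by ring
    have h1 : 2 ^ prT n ≤ prR n * 2 ^ prT n := Nat.le_mul_of_pos_left _ (by omega)
    have hp : 1 ≤ 2 ^ prT n := Nat.one_le_two_pow
    rw [hc]
    refine ⟨?_, ?_, ?_, ?_⟩
    · exact_mod_cast (by omega : 1 * n ≤ (Phi G (prR n) (prT n)).nvars)
    · exact_mod_cast (by omega : (Phi G (prR n) (prT n)).nvars ≤ 4801 * n)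
    · exact_mod_cast (by omega : 1 * n ≤ (Phi G (prR n) (prT n)).nvars + 1)
    · exact_mod_cast (by omega : (Phi G (prR n) (prT n)).nvars + 1 ≤ 4801 * n)
  · intro F _
    refine ⟨⟨21603, by norm_num, 2, fun n hn => ?_⟩, fun δ hδ => ?_,
      ⟨1 / 1000, by norm_num, 1 / 8, by norm_num, 2 ^ 64, fun n hn q s hq hd => ?_⟩⟩
    · obtain ⟨q, s, h1, h2⟩ := Phi_depth G (prR n) (prT n) F
      refine ⟨q, s, h1, ?_⟩
      obtain ⟨b1, b2, b3⟩ := pr_bounds n (by omega)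
      obtain ⟨l1, l2, l3⟩ := pr_log n hn
      have h3 : 1800 * ((prR n + 1) * (2 * prT n + 2)) + 3 ≤
          1800 * ((prR n + 1) * (2 * prR n)) + 3 := by
        gcongr; omega
      have h4 := h2.trans h3
      have h5 : ((nsDegree ((Phi G (prR n) (prT n)).polys F) q s : ℕ) : ℝ) ≤
          1800 * (((prR n : ℝ) + 1) * (2 * (prR n : ℝ))) + 3 := by exact_mod_cast h4
      refine h5.trans ?_
      have h6 : ((prR n : ℝ) + 1) * (2 * (prR n : ℝ)) ≤
          (3 * Real.logb 2 n) * (4 * Real.logb 2 n) :=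
        mul_le_mul (by linarith) (by linarith) (by positivity) (by linarith)
      have h7 : 1 ≤ (Real.logb 2 n) ^ 2 := one_le_pow₀ l1
      have h8 : (3 * Real.logb 2 n) * (4 * Real.logb 2 n) = 12 * (Real.logb 2 n) ^ 2 := by ring
      rw [h8] at h6
      clear h2 h3 h4 h5
      linarith
    · obtain ⟨k, C, hC, h⟩ := part2_num δ hδ
      refine ⟨C, hC, 2, fun n hn => ?_⟩
      obtain ⟨l, g1, g2, g3⟩ := h n hn
      obtain ⟨q, s, h1, h2, h3⟩ := Phi_layers G (prR n) (prT n) l k g1 F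
      exact ⟨q, s, h1, (Nat.cast_le.2 h3).trans g2, (Nat.cast_le.2 h2).trans g3⟩
    · obtain ⟨B, y, hB, hy, hm, hd', hfin⟩ := part3_num n hn
      refine hfin.trans (Nat.cast_le.2 ?_)
      exact Phi_lower G (prR n) (prT n) B y (Nat.succ_pos _) hy hB hm F q s hq
        (Nat.cast_lt.1 (lt_of_le_of_lt hd hd'))
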